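/- arXiv:1908.08069 — 3 statements merged into one kernel-verified Lean document; each statement's English description precedes it below -/
import Mathlib

section
/- For every n ≥ 2, the closure in U(2^n) of the subgroup generated by the gates {e^{iφX_j}, e^{iφZ_j}, e^{iφ·ZXZ_j} : φ ∈ ℝ, 1 ≤ j ≤ n} equals the special unitary group SU(2^n); in particular this gate set is universal. -/
open MeasureTheory Matrix Finset
open scoped Real ComplexConjugate ComplexOrder

noncomputable section

/-- The matrix exponential, defined by its power series. -/
def mexp {d : Type*} [Fintype d] [DecidableEq d] (A : Matrix d d ℂ) : Matrix d d ℂ :=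
  ∑' k : ℕ, ((k.factorial : ℂ))⁻¹ • A ^ k

/-- The Hilbert space of `n` qubits is indexed by bit strings `Fin n → Fin 2`. -/
abbrev QMat (n : ℕ) := Matrix (Fin n → Fin 2) (Fin n → Fin 2) ℂ

def pauliX : Matrix (Fin 2) (Fin 2) ℂ := !![0, 1; 1, 0]
def pauliZ : Matrix (Fin 2) (Fin 2) ℂ := !![1, 0; 0, -1]
def hadamardMat : Matrix (Fin 2) (Fin 2) ℂ :=
  (((Real.sqrt 2 : ℝ) : ℂ))⁻¹ • !![1, 1; 1, -1]

/-- A single-qubit operator `A` acting on qubit `i` of `n` qubits. -/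
def op1 {n : ℕ} (i : Fin n) (A : Matrix (Fin 2) (Fin 2) ℂ) : QMat n :=
  Matrix.of fun x y =>
    A (x i) (y i) * ∏ j ∈ Finset.univ.erase i, (if x j = y j then (1 : ℂ) else 0)

/-- Pauli `X` on qubit `i`. -/
def Xop {n : ℕ} (i : Fin n) : QMat n := op1 i pauliX
/-- Pauli `Z` on qubit `i`. -/
def Zop {n : ℕ} (i : Fin n) : QMat n := op1 i pauliZ

/-- `ZXZ_i = Z_{i-1} X_i Z_{i+1}`, with the `Z` factors dropped at the boundary
(so `ZXZ_1 = X_1 Z_2` and `ZXZ_n = Z_{n-1} X_n`). -/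
def ZXZop {n : ℕ} (i : Fin n) : QMat n :=
  (if h : 0 < (i : ℕ) then Zop ⟨(i : ℕ) - 1, by have := i.isLt; omega⟩ else 1) *
    Xop i *
    (if h : (i : ℕ) + 1 < n then Zop ⟨(i : ℕ) + 1, h⟩ else 1)

/-- The gate `e^{iφ A}`. -/
def rotGate {n : ℕ} (φ : ℝ) (A : QMat n) : QMat n :=
  mexp ((Complex.I * (φ : ℂ)) • A)

section Analysis

open NormedSpace

lemma norm_pow_sub_pow_le_of_norm_le_one {R : Type*} [NormedRing R] [NormOneClass R] {x y : R}
    (hx : ‖x‖ ≤ 1) (hy : ‖y‖ ≤ 1) (n : ℕ) : ‖x ^ n - y ^ n‖ ≤ n * ‖x - y‖ := by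
  induction n with
  | zero => simp
  | succ n ih =>
    have h : x ^ (n + 1) - y ^ (n + 1) = x ^ n * (x - y) + (x ^ n - y ^ n) * y := by
      rw [pow_succ, pow_succ]; noncomm_ring
    have hxn : ‖x ^ n‖ ≤ 1 := (norm_pow_le x n).trans (pow_le_one₀ (norm_nonneg _) hx)
    calc ‖x ^ (n + 1) - y ^ (n + 1)‖ ≤ ‖x ^ n‖ * ‖x - y‖ + ‖x ^ n - y ^ n‖ * ‖y‖ := by
          rw [h]; exact (norm_add_le _ _).trans (add_le_add (norm_mul_le _ _) (norm_mul_le _ _))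
      _ ≤ 1 * ‖x - y‖ + (n * ‖x - y‖) * 1 := by gcongr
      _ = (n + 1 : ℕ) * ‖x - y‖ := by push_cast; ring

/-- The Lie–Trotter product formula for generators of contraction groups. -/
lemma tendsto_exp_mul_exp_pow {R : Type*} [NormedRing R] [NormOneClass R] [NormedAlgebra ℝ R]
    [CompleteSpace R] {a b : R} (ha : ∀ t : ℝ, ‖exp (t • a)‖ ≤ 1) (hb : ∀ t : ℝ, ‖exp (t • b)‖ ≤ 1)
    (hab : ∀ t : ℝ, ‖exp (t • (a + b))‖ ≤ 1) :
    Filter.Tendsto (fun n : ℕ => (exp ((n : ℝ)⁻¹ • a) * exp ((n : ℝ)⁻¹ • b)) ^ n) Filter.atTop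
      (nhds (exp (a + b))) := by
  have hderiv (x : R) : HasDerivAt (fun t : ℝ => exp (t • x)) x 0 := by
    simpa using hasDerivAt_exp_smul_const (𝕂 := ℝ) x (0 : ℝ)
  have hf : HasDerivAt (fun t : ℝ => exp (t • a) * exp (t • b) - exp (t • (a + b))) 0 0 := by
    have h := ((hderiv a).mul (hderiv b)).sub (hderiv (a + b))
    simp only [zero_smul, exp_zero, mul_one, one_mul, sub_self] at h
    exact h
  have hlim := hf.tendsto_slope_zero_right.comp
    (tendsto_inv_atTop_nhdsGT_zero.comp (tendsto_natCast_atTop_atTop (R := ℝ)))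
  rw [tendsto_iff_norm_sub_tendsto_zero]
  refine squeeze_zero' (.of_forall fun _ => norm_nonneg _) ?_ (tendsto_norm_zero.comp hlim)
  filter_upwards [Filter.eventually_ge_atTop 1] with n hn
  have hn' : (n : ℝ) ≠ 0 := by positivity
  have hpow : exp (a + b) = exp ((n : ℝ)⁻¹ • (a + b)) ^ n := by
    let +nondep : NormedAlgebra ℚ R := .restrictScalars ℚ ℝ R
    rw [← NormedSpace.exp_nsmul, ← Nat.cast_smul_eq_nsmul ℝ, smul_smul, mul_inv_cancel₀ hn',
      one_smul]
  rw [hpow]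
  refine (norm_pow_sub_pow_le_of_norm_le_one ?_ (hab _) n).trans_eq ?_
  · exact (norm_mul_le _ _).trans (mul_le_one₀ (ha _) (norm_nonneg _) (hb _))
  · simp [norm_smul]

/-- Euler's formula for a square root of `-1` in a Banach algebra. -/
lemma exp_smul_of_mul_self_eq_neg_one {R : Type*} [NormedRing R] [NormedAlgebra ℝ R]
    [CompleteSpace R] {x : R} (hx : x * x = -1) (t : ℝ) :
    exp (t • x) = Real.cos t • (1 : R) + Real.sin t • x := by
  let +nondep : NormedAlgebra ℚ R := .restrictScalars ℚ ℝ R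
  have hderiv (t : ℝ) : HasDerivAt
      (fun t : ℝ => exp (t • -x) * (Real.cos t • (1 : R) + Real.sin t • x)) 0 t := by
    have h := (hasDerivAt_exp_smul_const (𝕂 := ℝ) (-x) t).mul
      (((Real.hasDerivAt_cos t).smul_const (1 : R)).add ((Real.hasDerivAt_sin t).smul_const x))
    refine h.congr_deriv ?_
    have hz : -x * (Real.cos t • (1 : R) + Real.sin t • x) +
        (-Real.sin t • (1 : R) + Real.cos t • x) = 0 := by
      rw [mul_add, mul_smul_comm, mul_smul_comm, mul_one, neg_mul, hx]
      module
    rw [Pi.add_apply, mul_assoc, ← mul_add, hz, mul_zero]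
  have hconst := is_const_of_deriv_eq_zero (fun t => (hderiv t).differentiableAt)
    (fun t => (hderiv t).deriv) t 0
  simp only [zero_smul, NormedSpace.exp_zero, Real.cos_zero, one_smul, Real.sin_zero, add_zero,
    mul_one] at hconst
  have hinv : exp (t • x) * exp (t • -x) = 1 := by
    rw [← NormedSpace.exp_add_of_commute (((Commute.refl x).neg_right.smul_left t).smul_right t)]
    simp
  calc exp (t • x) = exp (t • x) * (exp (t • -x) * (Real.cos t • (1 : R) + Real.sin t • x)) := by
        rw [hconst, mul_one]
    _ = _ := by rw [← mul_assoc, hinv, one_mul]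

end Analysis

open scoped Matrix.Norms.L2Operator in
/-- Every unitary matrix is the exponential of `i` times a Hermitian matrix. -/
lemma exists_isHermitian_exp_eq {m : Type*} [Fintype m] [DecidableEq m] {U : Matrix m m ℂ}
    (hU : U ∈ Matrix.unitaryGroup m ℂ) :
    ∃ H : Matrix m m ℂ, H.IsHermitian ∧ U = NormedSpace.exp (Complex.I • H) := by
  have hc (f : ℂ → ℂ) : ContinuousOn f (spectrum ℂ U) := U.finite_spectrum.continuousOn f
  have : IsStarNormal U :=
    ⟨(Unitary.star_mul_self_of_mem hU).trans (Unitary.mul_star_self_of_mem hU).symm⟩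
  refine ⟨cfc (Complex.ofReal ∘ Complex.arg : ℂ → ℂ) U, IsSelfAdjoint.cfc_arg U, ?_⟩
  rw [← CFC.complex_exp_eq_normedSpace_exp, ← cfc_smul _ _ _ (hc _),
    ← cfc_comp' _ _ _ (by fun_prop) (hc _)]
  conv_lhs => rw [← cfc_id' ℂ U]
  refine cfc_congr fun y hy ↦ ?_
  have hy₁ : ‖y‖ = 1 := spectrum.norm_eq_one_of_unitary (𝕜 := ℂ) (E := Matrix m m ℂ) hU hy
  simpa [hy₁, mul_comm] using (Complex.norm_mul_exp_arg_mul_I y).symm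

/-- The determinant of the exponential of `i` times a Hermitian matrix. -/
lemma Matrix.IsHermitian.det_exp_I_smul {m : Type*} [Fintype m] [DecidableEq m]
    {H : Matrix m m ℂ} (hH : H.IsHermitian) :
    (NormedSpace.exp (Complex.I • H)).det = Complex.exp (Complex.I * H.trace) := by
  have hspec := hH.spectral_theorem
  rw [Unitary.conjStarAlgAut_apply] at hspec
  have hinv : (star hH.eigenvectorUnitary : Matrix m m ℂ) =
      (hH.eigenvectorUnitary : Matrix m m ℂ)⁻¹ :=
    (Matrix.inv_eq_left_inv (Unitary.coe_star_mul_self _)).symm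
  have hunit : IsUnit (hH.eigenvectorUnitary : Matrix m m ℂ) := Unitary.isUnit_coe
  rw [hH.trace_eq_sum_eigenvalues]
  conv_lhs => rw [hspec, hinv, ← smul_mul_assoc, ← mul_smul_comm]
  rw [Matrix.exp_conj _ _ hunit, Matrix.det_conj hunit, ← Matrix.diagonal_smul,
    Matrix.exp_diagonal, Matrix.det_diagonal, Finset.mul_sum, Complex.exp_sum]
  refine Finset.prod_congr rfl fun i _ => ?_
  rw [Pi.coe_exp, ← Complex.exp_eq_exp_ℂ]
  simp

lemma exists_isHermitian_trace_eq_zero {m : Type*} [Fintype m] [DecidableEq m] [Nonempty m]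
    {U : Matrix m m ℂ} (hU : U ∈ Matrix.unitaryGroup m ℂ) (hdet : U.det = 1) :
    ∃ H : Matrix m m ℂ, H.IsHermitian ∧ H.trace = 0 ∧ U = NormedSpace.exp (Complex.I • H) := by
  obtain ⟨H, hH, rfl⟩ := exists_isHermitian_exp_eq hU
  rw [hH.det_exp_I_smul, Complex.exp_eq_one_iff] at hdet
  obtain ⟨k, hk⟩ := hdet
  have hspec := hH.spectral_theorem
  rw [Unitary.conjStarAlgAut_apply] at hspec
  set V : Matrix m m ℂ := (hH.eigenvectorUnitary : Matrix m m ℂ) with hV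
  have hVV : star V * V = 1 := Unitary.coe_star_mul_self _
  have hinv : star V = V⁻¹ := (Matrix.inv_eq_left_inv hVV).symm
  have hunit : IsUnit V := Unitary.isUnit_coe
  have hexp (D : Matrix m m ℂ) : NormedSpace.exp (Complex.I • (V * D * star V)) =
      V * NormedSpace.exp (Complex.I • D) * V⁻¹ := by
    rw [hinv, ← smul_mul_assoc, ← mul_smul_comm, Matrix.exp_conj _ _ hunit]
  have i₀ : m := Classical.arbitrary m
  let d : m → ℂ := (RCLike.ofReal ∘ hH.eigenvalues : m → ℂ) - Pi.single i₀ (2 * π * k : ℂ)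
  refine ⟨V * Matrix.diagonal d * star V, ?_, ?_, ?_⟩
  · rw [Matrix.star_eq_conjTranspose]
    refine Matrix.isHermitian_mul_mul_conjTranspose V (Matrix.isHermitian_diagonal_iff.2 fun i => ?_)
    by_cases hi : i = i₀
    · subst hi; simp [d, isSelfAdjoint_iff]
    · simp [d, hi, isSelfAdjoint_iff]
  · rw [Matrix.trace_mul_cycle, hVV, one_mul, Matrix.trace_diagonal]
    simp only [d, Pi.sub_apply, Finset.sum_sub_distrib, Function.comp_apply]
    rw [← hH.trace_eq_sum_eigenvalues, Finset.sum_pi_single']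
    simp only [Finset.mem_univ, if_true]
    linear_combination (-Complex.I) * hk + (H.trace - 2 * π * k) * Complex.I_sq
  · conv_lhs => rw [hspec]
    rw [hexp, hexp, ← Matrix.diagonal_smul, ← Matrix.diagonal_smul, Matrix.exp_diagonal,
      Matrix.exp_diagonal]
    congr 3
    ext i
    rw [Pi.coe_exp, Pi.coe_exp, ← Complex.exp_eq_exp_ℂ]
    by_cases hi : i = i₀
    · subst hi
      rw [Complex.exp_eq_exp_iff_exists_int]
      exact ⟨k, by simp [d]; ring⟩
    · simp [d, hi]

lemma mexp_eq_exp {m : Type*} [Fintype m] [DecidableEq m] (A : Matrix m m ℂ) :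
    mexp A = NormedSpace.exp A := by
  rw [NormedSpace.exp_eq_tsum ℂ, mexp]

section Generators

open NormedSpace

variable {m : Type*} [Fintype m] [DecidableEq m]

lemma exp_I_smul_mem_unitaryGroup {A : Matrix m m ℂ} (hA : A.IsHermitian) (t : ℝ) :
    exp ((Complex.I * t) • A) ∈ Matrix.unitaryGroup m ℂ := by
  rw [Matrix.mem_unitaryGroup_iff, Matrix.star_eq_conjTranspose, ← Matrix.exp_conjTranspose,
    Matrix.conjTranspose_smul, hA.eq, ← Matrix.exp_add_of_commute]
  · simp
  · exact ((Commute.refl A).smul_left _).smul_right _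

/-- The Hermitian matrices whose one-parameter unitary group lies in `S`. -/
def hermitianGenerators (S : Submonoid (Matrix m m ℂ)) : Set (Matrix m m ℂ) :=
  {A | A.IsHermitian ∧ ∀ t : ℝ, exp ((Complex.I * t) • A) ∈ S}

variable {S : Submonoid (Matrix m m ℂ)} {A B : Matrix m m ℂ}

lemma smul_mem_hermitianGenerators (hA : A ∈ hermitianGenerators S) (r : ℝ) :
    r • A ∈ hermitianGenerators S := by
  refine ⟨?_, fun t => ?_⟩
  · rw [Matrix.IsHermitian, Matrix.conjTranspose_smul, hA.1.eq, star_trivial]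
  · have h := hA.2 (t * r)
    rwa [← Complex.coe_smul, smul_smul, mul_assoc, ← Complex.ofReal_mul]

open scoped Matrix.Norms.L2Operator in
lemma add_mem_hermitianGenerators (hS : IsClosed (S : Set (Matrix m m ℂ)))
    (hA : A ∈ hermitianGenerators S) (hB : B ∈ hermitianGenerators S) :
    A + B ∈ hermitianGenerators S := by
  refine ⟨hA.1.add hB.1, fun t => ?_⟩
  cases isEmpty_or_nonempty m
  · rw [Subsingleton.elim (exp _) (1 : Matrix m m ℂ)]; exact S.one_mem
  have hsmul (C : Matrix m m ℂ) (r : ℝ) :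
      (Complex.I * (t * r : ℝ)) • C = r • ((Complex.I * t) • C) := by
    rw [← Complex.coe_smul, smul_smul]; push_cast; ring_nf
  have key {C : Matrix m m ℂ} (hC : C.IsHermitian) (r : ℝ) :
      ‖exp (r • ((Complex.I * t) • C))‖ ≤ 1 := by
    have h := exp_I_smul_mem_unitaryGroup hC (t * r)
    rw [hsmul] at h
    exact (CStarRing.norm_of_mem_unitary h).le
  rw [smul_add]
  refine hS.mem_of_tendsto (tendsto_exp_mul_exp_pow (key hA.1) (key hB.1)
    (by rw [← smul_add]; exact key (hA.1.add hB.1))) (.of_forall fun n => ?_)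
  refine S.pow_mem (S.mul_mem ?_ ?_) n
  · have h := hA.2 (t * (n : ℝ)⁻¹)
    rwa [hsmul] at h
  · have h := hB.2 (t * (n : ℝ)⁻¹)
    rwa [hsmul] at h

lemma zero_mem_hermitianGenerators : (0 : Matrix m m ℂ) ∈ hermitianGenerators S :=
  ⟨Matrix.isHermitian_zero, fun t => by simp [S.one_mem]⟩

open scoped Matrix.Norms.L2Operator in
lemma exp_I_smul_of_mul_self_eq_one (hA : A * A = 1) (t : ℝ) :
    exp ((Complex.I * t) • A) =
      (Real.cos t : ℂ) • (1 : Matrix m m ℂ) + (Real.sin t * Complex.I) • A := by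
  have h := exp_smul_of_mul_self_eq_neg_one (x := Complex.I • A) (by
    rw [smul_mul_smul_comm, hA, Complex.I_mul_I, neg_one_smul]) t
  simp only [← Complex.coe_smul, smul_smul] at h
  rwa [mul_comm]

/-- Conjugating one generator by a quarter rotation about an anticommuting involution. -/
lemma I_smul_mul_mem_hermitianGenerators (hA : A ∈ hermitianGenerators S)
    (hB : B ∈ hermitianGenerators S) (hA2 : A * A = 1) (hAB : B * A = -(A * B)) :
    Complex.I • (A * B) ∈ hermitianGenerators S := by
  refine ⟨?_, fun t => ?_⟩
  · rw [Matrix.IsHermitian, Matrix.conjTranspose_smul, Matrix.conjTranspose_mul, hA.1.eq, hB.1.eq,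
      hAB]
    simp
  set U := exp ((Complex.I * (π / 4 : ℝ)) • A) with hU
  set V := exp ((Complex.I * (-(π / 4) : ℝ)) • A) with hV
  have hUV : U * V = 1 := by
    rw [hU, hV, ← Matrix.exp_add_of_commute _ _
      (((Commute.refl A).smul_left _).smul_right _), ← add_smul]
    simp
  have hinv : V = U⁻¹ := (Matrix.inv_eq_right_inv hUV).symm
  have hconj : Complex.I • (A * B) = U * B * V := by
    have hABA : A * B * A = -B := by rw [mul_assoc, hAB, mul_neg, ← mul_assoc, hA2, one_mul]
    have hc : (Real.cos (π / 4) : ℂ) * Real.cos (π / 4) = 1 / 2 := by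
      rw [Real.cos_pi_div_four, ← Complex.ofReal_mul]
      rw [div_mul_div_comm, Real.mul_self_sqrt zero_le_two]; norm_num
    have hs : Real.sin (π / 4) = Real.cos (π / 4) := by
      rw [Real.sin_pi_div_four, Real.cos_pi_div_four]
    rw [hU, hV, exp_I_smul_of_mul_self_eq_one hA2, exp_I_smul_of_mul_self_eq_one hA2,
      Real.cos_neg, Real.sin_neg, hs]
    simp only [add_mul, mul_add, smul_mul_assoc, mul_smul_comm, one_mul, mul_one, hAB, hABA,
      smul_neg, Complex.ofReal_neg]
    set c : ℂ := (Real.cos (π / 4) : ℂ)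
    rw [← sub_eq_zero]
    match_scalars
    · linear_combination (-2 * Complex.I) * hc
    · linear_combination (-1 - Complex.I ^ 2) * hc - (1 / 2) * Complex.I_sq
  have hunit : IsUnit U := Matrix.isUnit_exp _
  rw [hconj, hinv, ← smul_mul_assoc, ← mul_smul_comm, Matrix.exp_conj _ _ hunit, ← hinv]
  exact S.mul_mem (S.mul_mem (hA.2 _) (hB.2 _)) (hA.2 _)

end Generators

section PauliStrings

/-- The tensor product of single-qubit operators. -/
def tensorOp {n : ℕ} (A : Fin n → Matrix (Fin 2) (Fin 2) ℂ) : QMat n :=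
  Matrix.of fun x y => ∏ i, A i (x i) (y i)

variable {n : ℕ}

lemma tensorOp_mul (A B : Fin n → Matrix (Fin 2) (Fin 2) ℂ) :
    tensorOp A * tensorOp B = tensorOp (A * B) := by
  ext x y
  simp only [tensorOp, Matrix.mul_apply, Matrix.of_apply, Pi.mul_apply, Finset.prod_univ_sum,
    Fintype.piFinset_univ, Finset.prod_mul_distrib]

lemma tensorOp_one : tensorOp (1 : Fin n → Matrix (Fin 2) (Fin 2) ℂ) = 1 := by
  ext x y
  simp [tensorOp, Matrix.one_apply, Finset.prod_ite_zero, funext_iff]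

lemma tensorOp_smul (c : Fin n → ℂ) (A : Fin n → Matrix (Fin 2) (Fin 2) ℂ) :
    tensorOp (fun i => c i • A i) = (∏ i, c i) • tensorOp A := by
  ext x y
  simp [tensorOp, Finset.prod_mul_distrib]

lemma tensorOp_sum {ι : Type*} [Fintype ι] [DecidableEq ι]
    (A : Fin n → ι → Matrix (Fin 2) (Fin 2) ℂ) :
    tensorOp (fun i => ∑ k, A i k) = ∑ s : Fin n → ι, tensorOp fun i => A i (s i) := by
  ext x y
  simp [tensorOp, Matrix.sum_apply, Finset.prod_univ_sum]

lemma conjTranspose_tensorOp (A : Fin n → Matrix (Fin 2) (Fin 2) ℂ) :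
    (tensorOp A)ᴴ = tensorOp fun i => (A i)ᴴ := by
  ext x y
  simp [tensorOp]

lemma trace_tensorOp (A : Fin n → Matrix (Fin 2) (Fin 2) ℂ) :
    (tensorOp A).trace = ∏ i, (A i).trace := by
  simp only [tensorOp, Matrix.trace, Matrix.diag_apply, Matrix.of_apply, Finset.prod_univ_sum,
    Fintype.piFinset_univ]

lemma op1_eq_tensorOp (i : Fin n) (A : Matrix (Fin 2) (Fin 2) ℂ) :
    op1 i A = tensorOp (Pi.mulSingle i A) := by
  ext x y
  rw [op1, tensorOp, Matrix.of_apply, Matrix.of_apply,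
    ← Finset.mul_prod_erase _ _ (Finset.mem_univ i), Pi.mulSingle_eq_same]
  congr 1
  refine Finset.prod_congr rfl fun j hj => ?_
  rw [Pi.mulSingle_eq_of_ne (Finset.ne_of_mem_erase hj), Matrix.one_apply]

/-- The Pauli matrices `1, X, Y, Z`. -/
def pauli : Fin 4 → Matrix (Fin 2) (Fin 2) ℂ :=
  ![1, pauliX, !![0, -Complex.I; Complex.I, 0], pauliZ]

lemma conjTranspose_pauli (a : Fin 4) : (pauli a)ᴴ = pauli a := by
  fin_cases a <;> ext i j <;> fin_cases i <;> fin_cases j <;> simp [pauli, pauliX, pauliZ]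

lemma pauli_mul_self (a : Fin 4) : pauli a * pauli a = 1 := by
  fin_cases a <;> ext i j <;> fin_cases i <;> fin_cases j <;> simp [pauli, pauliX, pauliZ]

lemma trace_pauli {a : Fin 4} (ha : a ≠ 0) : (pauli a).trace = 0 := by
  fin_cases a <;> simp_all [pauli, pauliX, pauliZ, Matrix.trace]

lemma pauli_anticomm {a b : Fin 4} (ha : a ≠ 0) (hb : b ≠ 0) (hab : a ≠ b) :
    pauli b * pauli a = -(pauli a * pauli b) := by
  fin_cases a <;> fin_cases b <;> first | contradiction | skip
  all_goals ext i j; fin_cases i <;> fin_cases j <;> simp [pauli, pauliX, pauliZ]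

lemma exists_pauli_eq_smul_mul {a b c : Fin 4} (ha : a ≠ 0) (hb : b ≠ 0) (hc : c ≠ 0)
    (hab : a ≠ b) (hac : a ≠ c) (hbc : b ≠ c) :
    ∃ r : ℝ, pauli c = ((r : ℂ) * Complex.I) • (pauli a * pauli b) := by
  have key : pauli c = (((1 : ℝ) : ℂ) * Complex.I) • (pauli a * pauli b) ∨
      pauli c = (((-1 : ℝ) : ℂ) * Complex.I) • (pauli a * pauli b) := by
    fin_cases a <;> fin_cases b <;> fin_cases c <;> first | contradiction | skip
    all_goals solve
      | (left; ext i j; fin_cases i <;> fin_cases j <;> simp [pauli, pauliX, pauliZ])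
      | (right; ext i j; fin_cases i <;> fin_cases j <;> simp [pauli, pauliX, pauliZ])
  exact key.elim (fun h => ⟨_, h⟩) fun h => ⟨_, h⟩

lemma exists_eq_sum_smul_pauli (M : Matrix (Fin 2) (Fin 2) ℂ) :
    ∃ c : Fin 4 → ℂ, M = ∑ a, c a • pauli a := by
  refine ⟨![(M 0 0 + M 1 1) / 2, (M 0 1 + M 1 0) / 2, Complex.I * (M 0 1 - M 1 0) / 2,
    (M 0 0 - M 1 1) / 2], ?_⟩
  ext i j
  have := Complex.I_sq
  fin_cases i <;> fin_cases j <;>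
    simp [pauli, pauliX, pauliZ, Fin.sum_univ_four] <;> grind

/-- The tensor product of Pauli matrices. -/
def pauliString (s : Fin n → Fin 4) : QMat n := tensorOp fun i => pauli (s i)

lemma isHermitian_pauliString (s : Fin n → Fin 4) : (pauliString s).IsHermitian := by
  simp [Matrix.IsHermitian, pauliString, conjTranspose_tensorOp, conjTranspose_pauli]

lemma pauliString_mul_self (s : Fin n → Fin 4) : pauliString s * pauliString s = 1 := by
  rw [pauliString, tensorOp_mul, ← tensorOp_one]
  congr 1
  ext1 i
  exact pauli_mul_self _

lemma trace_pauliString {s : Fin n → Fin 4} (hs : s ≠ 0) : (pauliString s).trace = 0 := by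
  obtain ⟨i, hi⟩ := Function.ne_iff.1 hs
  rw [pauliString, trace_tensorOp]
  exact Finset.prod_eq_zero (Finset.mem_univ i) (trace_pauli hi)

lemma pauliString_zero : pauliString (0 : Fin n → Fin 4) = 1 := by
  rw [← tensorOp_one]; rfl

lemma exists_eq_sum_smul_pauliString (M : QMat n) :
    ∃ c : (Fin n → Fin 4) → ℂ, ∑ s, c s • pauliString s = M := by
  rw [← Submodule.mem_span_range_iff_exists_fun, Matrix.matrix_eq_sum_single M]
  refine Submodule.sum_mem _ fun x _ => Submodule.sum_mem _ fun y _ => ?_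
  rw [← mul_one (M x y), ← smul_eq_mul, ← Matrix.smul_single]
  refine Submodule.smul_mem _ _ ?_
  choose c hc using fun i : Fin n =>
    exists_eq_sum_smul_pauli (Matrix.single (x i) (y i) (1 : ℂ))
  have hsingle : Matrix.single x y (1 : ℂ) =
      tensorOp fun i => Matrix.single (x i) (y i) (1 : ℂ) := by
    ext x' y'
    simp [tensorOp, Matrix.single_apply, Finset.prod_ite_zero, funext_iff, forall_and]
  rw [hsingle]
  simp only [hc]
  rw [tensorOp_sum]
  refine Submodule.sum_mem _ fun s _ => ?_
  rw [tensorOp_smul (fun i => c i (s i)) fun i => pauli (s i)]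
  exact Submodule.smul_mem _ _ (Submodule.subset_span ⟨s, rfl⟩)

/-- A traceless Hermitian operator is a real combination of nontrivial Pauli strings. -/
lemma exists_eq_sum_real_smul_pauliString {H : QMat n} (hH : H.IsHermitian) (htr : H.trace = 0) :
    ∃ r : (Fin n → Fin 4) → ℝ, r 0 = 0 ∧ H = ∑ s, r s • pauliString s := by
  obtain ⟨c, hc⟩ := exists_eq_sum_smul_pauliString H
  have hre : H = ∑ s, (c s).re • pauliString s := by
    have h2 : H = (1 / 2 : ℂ) • (H + Hᴴ) := by
      rw [hH.eq, ← two_smul ℂ, smul_smul]; norm_num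
    rw [h2, ← hc, Matrix.conjTranspose_sum, ← Finset.sum_add_distrib, Finset.smul_sum]
    refine Finset.sum_congr rfl fun s _ => ?_
    rw [Matrix.conjTranspose_smul, (isHermitian_pauliString s).eq, ← add_smul, smul_smul,
      ← Complex.coe_smul]
    congr 1
    rw [Complex.re_eq_add_conj]
    simp only [RCLike.star_def]
    ring
  refine ⟨fun s => (c s).re, ?_, hre⟩
  rw [hre, Matrix.trace_sum, Finset.sum_eq_single 0] at htr
  · simpa [pauliString_zero] using htr
  · intro s _ hs
    rw [Matrix.trace_smul, trace_pauliString hs, smul_zero]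
  · simp

end PauliStrings

section Supports

variable {n : ℕ}

/-- A set of Pauli strings that contains all single-qubit ones and is closed under products of
strings `s`, `t` that anticommute at one qubit `i₀` and, at every other qubit, agree or are not
both nontrivial; `u` is the product up to phase. -/
structure IsPauliClosed (Q : (Fin n → Fin 4) → Prop) : Prop where
  single : ∀ i a, a ≠ 0 → Q (Pi.single i a)
  merge : ∀ (s t u : Fin n → Fin 4) (i₀ : Fin n), s i₀ ≠ 0 → t i₀ ≠ 0 → u i₀ ≠ 0 →
    s i₀ ≠ t i₀ → s i₀ ≠ u i₀ → t i₀ ≠ u i₀ →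
    (∀ i ≠ i₀, s i = 0 ∧ u i = t i ∨ t i = 0 ∧ u i = s i ∨ s i = t i ∧ u i = 0) →
    Q s → Q t → Q u

namespace IsPauliClosed

variable {Q : (Fin n → Fin 4) → Prop}

lemma update (hQ : IsPauliClosed Q) {s : Fin n → Fin 4} {i : Fin n} {a : Fin 4} (hs : Q s)
    (hi : s i ≠ 0) (ha : a ≠ 0) : Q (Function.update s i a) := by
  by_cases hsa : s i = a
  · rwa [← hsa, Function.update_eq_self]
  · obtain ⟨c, hc, hcs, hca⟩ : ∃ c : Fin 4, c ≠ 0 ∧ c ≠ s i ∧ c ≠ a := by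
      generalize s i = b
      clear * -
      decide +revert
    refine hQ.merge (Pi.single i c) s _ i (by simpa) hi (by simpa) (by simpa) (by simpa)
      (by simpa) (fun j hj => ?_) (hQ.single i c hc) hs
    simp [hj]

/-- Membership depends only on the support of a string. -/
lemma of_support (hQ : IsPauliClosed Q) {s t : Fin n → Fin 4} (hs : Q s)
    (hst : ∀ i, t i = 0 ↔ s i = 0) : Q t := by
  have key (R : Finset (Fin n)) : Q (R.piecewise t s) := by
    induction R using Finset.induction_on with
    | empty => simpa
    | insert i R hi ih =>
      rw [Finset.piecewise_insert]
      have hval : R.piecewise t s i = s i := Finset.piecewise_eq_of_notMem _ _ _ hi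
      by_cases h : s i = 0
      · rwa [(hst i).2 h, ← h, ← hval, Function.update_eq_self]
      · exact hQ.update ih (by rwa [hval]) (mt (hst i).1 h)
  simpa using key Finset.univ

/-- All strings with support `T` satisfy `Q`. -/
def HasSupport (Q : (Fin n → Fin 4) → Prop) (T : Finset (Fin n)) : Prop :=
  ∀ s, (∀ i, s i ≠ 0 ↔ i ∈ T) → Q s

lemma hasSupport (hQ : IsPauliClosed Q) {s : Fin n → Fin 4} {T : Finset (Fin n)} (hs : Q s)
    (hT : ∀ i, s i ≠ 0 ↔ i ∈ T) : HasSupport Q T := fun _ ht =>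
  hQ.of_support hs fun i => not_iff_not.1 ((ht i).trans (hT i).symm)

lemma hasSupport_insert_symmDiff (hQ : IsPauliClosed Q) {T T' : Finset (Fin n)} {i₀ : Fin n}
    (hT : HasSupport Q T) (hT' : HasSupport Q T') (h : i₀ ∈ T) (h' : i₀ ∈ T') :
    HasSupport Q (insert i₀ (symmDiff T T')) := by
  let s : Fin n → Fin 4 := fun i => if i ∈ T then 3 else 0
  let t : Fin n → Fin 4 := fun i => if i = i₀ then 1 else if i ∈ T' then 3 else 0
  let u : Fin n → Fin 4 := fun i => if i = i₀ then 2 else if i ∈ symmDiff T T' then 3 else 0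
  have hu : Q u := by
    refine hQ.merge s t u i₀ ?_ ?_ ?_ ?_ ?_ ?_ (fun i hi => ?_) (hT s fun i => ?_)
      (hT' t fun i => ?_)
    any_goals simp [s, t, u, h]; done
    · by_cases h1 : i ∈ T <;> by_cases h2 : i ∈ T' <;>
        simp [s, t, u, hi, h1, h2, Finset.mem_symmDiff]
    · by_cases hi : i = i₀ <;> simp [t, hi, h']
  refine hQ.hasSupport hu fun i => ?_
  by_cases hi : i = i₀ <;> simp [u, hi]

lemma hasSupport_singleton (hQ : IsPauliClosed Q) (i : Fin n) : HasSupport Q {i} :=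
  hQ.hasSupport (hQ.single i 3 (by decide)) fun j => by
    by_cases hj : j = i <;> simp [hj]

lemma hasSupport_pair_trans (hQ : IsPauliClosed Q) {i j k : Fin n} (hij : i ≠ j) (hjk : j ≠ k)
    (hik : i ≠ k) (h : HasSupport Q {i, j}) (h' : HasSupport Q {j, k}) : HasSupport Q {i, k} := by
  have h3 := hQ.hasSupport_insert_symmDiff (i₀ := j) h h' (by simp) (by simp)
  have h4 := hQ.hasSupport_insert_symmDiff (i₀ := k) h3 h'
    (by simp [Finset.mem_symmDiff, hik.symm, hjk.symm]) (by simp)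
  convert h4 using 1
  ext l
  simp only [Finset.mem_insert, Finset.mem_singleton, Finset.mem_symmDiff]
  grind

lemma hasSupport_adjacent (hQ : IsPauliClosed Q)
    (h01 : ∀ i j : Fin n, (i : ℕ) = 0 → (j : ℕ) = 1 → HasSupport Q {i, j})
    (h3 : ∀ i j k : Fin n, (j : ℕ) = i + 1 → (k : ℕ) = j + 1 → HasSupport Q {i, j, k})
    (i : ℕ) (hi : i + 1 < n) : HasSupport Q {⟨i, by omega⟩, ⟨i + 1, hi⟩} := by
  induction i with
  | zero => exact h01 _ _ rfl rfl
  | succ i ih =>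
    have h := hQ.hasSupport_insert_symmDiff (i₀ := ⟨i + 1, by omega⟩) (ih (by omega))
      (h3 ⟨i, by omega⟩ ⟨i + 1, by omega⟩ ⟨i + 1 + 1, hi⟩ rfl rfl) (by simp) (by simp)
    convert h using 1
    ext l
    simp only [Finset.mem_insert, Finset.mem_singleton, Finset.mem_symmDiff, Fin.ext_iff]
    omega

lemma hasSupport_pair (hQ : IsPauliClosed Q)
    (hadj : ∀ (i : ℕ) (hi : i + 1 < n), HasSupport Q {⟨i, by omega⟩, ⟨i + 1, hi⟩})
    {i j : Fin n} (hij : i < j) : HasSupport Q {i, j} := by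
  obtain ⟨i, hi⟩ := i
  obtain ⟨j, hj⟩ := j
  rw [Fin.mk_lt_mk] at hij
  induction j, hij using Nat.le_induction with
  | base => exact hadj i hj
  | succ j hij ih =>
    refine hQ.hasSupport_pair_trans ?_ ?_ ?_ (ih (by omega)) (hadj j hj)
    all_goals simp only [ne_eq, Fin.mk.injEq]; omega

lemma hasSupport_of_nonempty (hQ : IsPauliClosed Q)
    (hpair : ∀ i j : Fin n, i ≠ j → HasSupport Q {i, j}) {T : Finset (Fin n)}
    (hT : T.Nonempty) : HasSupport Q T := by
  induction hT using Finset.Nonempty.cons_induction with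
  | singleton i => exact hQ.hasSupport_singleton i
  | cons j T hj hT ih =>
    obtain ⟨i, hi⟩ := hT
    have hij : i ≠ j := fun h => hj (h ▸ hi)
    have h := hQ.hasSupport_insert_symmDiff (i₀ := i) ih (hpair i j hij) hi (by simp)
    convert h using 1
    ext l
    simp only [Finset.mem_cons, Finset.mem_insert, Finset.mem_singleton, Finset.mem_symmDiff]
    grind

/-- Single-qubit strings, a string on the first two qubits, and strings on three consecutive
qubits generate all nontrivial strings. -/
lemma of_ne_zero (hQ : IsPauliClosed Q)
    (h01 : ∀ i j : Fin n, (i : ℕ) = 0 → (j : ℕ) = 1 → HasSupport Q {i, j})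
    (h3 : ∀ i j k : Fin n, (j : ℕ) = i + 1 → (k : ℕ) = j + 1 → HasSupport Q {i, j, k})
    {s : Fin n → Fin 4} (hs : s ≠ 0) : Q s := by
  have hpair (i j : Fin n) (hij : i ≠ j) : HasSupport Q {i, j} := by
    rcases lt_or_gt_of_ne hij with h | h
    · exact hQ.hasSupport_pair (hQ.hasSupport_adjacent h01 h3) h
    · rw [Finset.pair_comm]
      exact hQ.hasSupport_pair (hQ.hasSupport_adjacent h01 h3) h
  obtain ⟨i, hi⟩ := Function.ne_iff.1 hs
  exact hQ.hasSupport_of_nonempty hpair (T := {i | s i ≠ 0}) ⟨i, by simpa using hi⟩ s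
    fun j => by simp

end IsPauliClosed

end Supports

section Gates

variable {n : ℕ} {S : Submonoid (QMat n)}

lemma pauliString_mem_of_merge {s t u : Fin n → Fin 4} {i₀ : Fin n}
    (hs0 : s i₀ ≠ 0) (ht0 : t i₀ ≠ 0) (hu0 : u i₀ ≠ 0) (hst : s i₀ ≠ t i₀) (hsu : s i₀ ≠ u i₀)
    (htu : t i₀ ≠ u i₀)
    (h : ∀ i ≠ i₀, s i = 0 ∧ u i = t i ∨ t i = 0 ∧ u i = s i ∨ s i = t i ∧ u i = 0)
    (hs : pauliString s ∈ hermitianGenerators S) (ht : pauliString t ∈ hermitianGenerators S) :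
    pauliString u ∈ hermitianGenerators S := by
  have hprod (c : ℂ) : ∏ i, Function.update (1 : Fin n → ℂ) i₀ c i = c := by
    simp [Finset.prod_update_of_mem]
  have hzero : pauli 0 = 1 := rfl
  have hoff (i : Fin n) (hi : i ≠ i₀) : pauli (u i) = pauli (s i) * pauli (t i) ∧
      pauli (t i) * pauli (s i) = pauli (s i) * pauli (t i) := by
    rcases h i hi with ⟨h1, h2⟩ | ⟨h1, h2⟩ | ⟨h1, h2⟩ <;> simp [h1, h2, hzero, pauli_mul_self]
  have hanti : pauliString t * pauliString s = -(pauliString s * pauliString t) := by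
    rw [pauliString, pauliString, tensorOp_mul, tensorOp_mul, ← neg_one_smul ℂ, ← hprod (-1),
      ← tensorOp_smul]
    congr 1
    ext1 i
    by_cases hi : i = i₀
    · subst hi; simp [pauli_anticomm hs0 ht0 hst]
    · simp [hi, (hoff i hi).2]
  obtain ⟨r, hr⟩ := exists_pauli_eq_smul_mul hs0 ht0 hu0 hst hsu htu
  have hu : pauliString u = r • Complex.I • (pauliString s * pauliString t) := by
    rw [← Complex.coe_smul, smul_smul, pauliString, pauliString, pauliString, tensorOp_mul,
      ← hprod (r * Complex.I), ← tensorOp_smul]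
    congr 1
    ext1 i
    by_cases hi : i = i₀
    · subst hi; simp [hr]
    · simp [hi, (hoff i hi).1]
  rw [hu]
  exact smul_mem_hermitianGenerators
    (I_smul_mul_mem_hermitianGenerators hs ht (pauliString_mul_self s) hanti) r

lemma Xop_eq_pauliString (i : Fin n) : Xop i = pauliString (Pi.single i 1) := by
  rw [Xop, op1_eq_tensorOp, pauliString]
  congr 1
  ext1 j
  by_cases hj : j = i
  · subst hj; simp [pauli]
  · simp [hj, pauli]

lemma Zop_eq_pauliString (i : Fin n) : Zop i = pauliString (Pi.single i 3) := by
  rw [Zop, op1_eq_tensorOp, pauliString]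
  congr 1
  ext1 j
  by_cases hj : j = i
  · subst hj; simp [pauli]
  · simp [hj, pauli]

/-- The Pauli string of `ZXZop i`. -/
def zxzString (i : Fin n) : Fin n → Fin 4 := fun j =>
  if j = i then 1 else if (j : ℕ) + 1 = i ∨ (j : ℕ) = i + 1 then 3 else 0

lemma ZXZop_eq_pauliString (i : Fin n) : ZXZop i = pauliString (zxzString i) := by
  have hj (j : Fin n) : Zop j = tensorOp (Pi.mulSingle j pauliZ) := op1_eq_tensorOp _ _
  have hleft : (if h : 0 < (i : ℕ) then Zop ⟨(i : ℕ) - 1, by have := i.isLt; omega⟩ else 1) =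
      tensorOp fun j : Fin n => if (j : ℕ) + 1 = i then pauliZ else 1 := by
    split_ifs with h
    · rw [hj]
      congr 1
      ext1 j
      simp only [Pi.mulSingle_apply, Fin.ext_iff]
      congr 1
      simp only [eq_iff_iff]
      omega
    · rw [← tensorOp_one]
      congr 1
      ext1 j
      rw [if_neg (by omega), Pi.one_apply]
  have hright : (if h : (i : ℕ) + 1 < n then Zop ⟨(i : ℕ) + 1, h⟩ else 1) =
      tensorOp fun j : Fin n => if (j : ℕ) = i + 1 then pauliZ else 1 := by
    split_ifs with h
    · rw [hj]
      congr 1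
      ext1 j
      simp only [Pi.mulSingle_apply, Fin.ext_iff]
    · rw [← tensorOp_one]
      congr 1
      ext1 j
      rw [if_neg (by omega), Pi.one_apply]
  rw [ZXZop, hleft, hright, Xop, op1_eq_tensorOp, tensorOp_mul, tensorOp_mul, pauliString]
  congr 1
  ext1 j
  simp only [Pi.mul_apply, Pi.mulSingle_apply, zxzString, Fin.ext_iff]
  split_ifs <;> first | omega | simp [pauli]

lemma isPauliClosed_hermitianGenerators (hX : ∀ i : Fin n, Xop i ∈ hermitianGenerators S)
    (hZ : ∀ i : Fin n, Zop i ∈ hermitianGenerators S) :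
    IsPauliClosed fun s : Fin n → Fin 4 => pauliString s ∈ hermitianGenerators S where
  single i a ha := by
    have h1 : pauliString (Pi.single i 1) ∈ hermitianGenerators S := Xop_eq_pauliString i ▸ hX i
    have h3 : pauliString (Pi.single i 3) ∈ hermitianGenerators S := Zop_eq_pauliString i ▸ hZ i
    have h2 : pauliString (Pi.single i 2) ∈ hermitianGenerators S :=
      pauliString_mem_of_merge (i₀ := i) (by simp) (by simp) (by simp) (by simp) (by simp)
        (by simp) (fun j hj => by simp [hj]) h1 h3
    fin_cases a
    exacts [absurd rfl ha, h1, h2, h3]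
  merge _ _ _ _ := pauliString_mem_of_merge

/-- Every traceless Hermitian operator generates gates in a closed submonoid containing the
`X`, `Z` and `ZXZ` rotations. -/
lemma mem_hermitianGenerators_of_trace_eq_zero (hS : IsClosed (S : Set (QMat n)))
    (hX : ∀ i : Fin n, Xop i ∈ hermitianGenerators S)
    (hZ : ∀ i : Fin n, Zop i ∈ hermitianGenerators S)
    (hZXZ : ∀ i : Fin n, ZXZop i ∈ hermitianGenerators S) {H : QMat n} (hH : H.IsHermitian)
    (htr : H.trace = 0) : H ∈ hermitianGenerators S := by
  have hQ := isPauliClosed_hermitianGenerators hX hZ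
  have hzxz (i : Fin n) : pauliString (zxzString i) ∈ hermitianGenerators S :=
    ZXZop_eq_pauliString i ▸ hZXZ i
  obtain ⟨r, hr0, rfl⟩ := exists_eq_sum_real_smul_pauliString hH htr
  refine Finset.sum_induction _ (· ∈ hermitianGenerators S)
    (fun _ _ => add_mem_hermitianGenerators hS) zero_mem_hermitianGenerators fun s _ => ?_
  by_cases hs : s = 0
  · rw [hs, hr0, zero_smul]
    exact zero_mem_hermitianGenerators
  · refine smul_mem_hermitianGenerators (hQ.of_ne_zero (fun i j hi hj => ?_)
      (fun i j k hj hk => ?_) hs) _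
    · refine hQ.hasSupport (hzxz i) fun l => ?_
      simp only [zxzString, Finset.mem_insert, Finset.mem_singleton, Fin.ext_iff]
      split_ifs <;> simp <;> omega
    · refine hQ.hasSupport (hzxz j) fun l => ?_
      simp only [zxzString, Finset.mem_insert, Finset.mem_singleton, Fin.ext_iff]
      split_ifs <;> simp <;> omega

lemma rotGate_pauliString_mem_specialUnitaryGroup {s : Fin n → Fin 4} (hs : s ≠ 0) (φ : ℝ) :
    rotGate φ (pauliString s) ∈ Matrix.specialUnitaryGroup (Fin n → Fin 2) ℂ := by
  rw [rotGate, mexp_eq_exp, Matrix.mem_specialUnitaryGroup_iff]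
  refine ⟨exp_I_smul_mem_unitaryGroup (isHermitian_pauliString s) φ, ?_⟩
  have hH : ((φ : ℂ) • pauliString s).IsHermitian := by
    simp [Matrix.IsHermitian, Matrix.conjTranspose_smul, (isHermitian_pauliString s).eq]
  rw [← smul_smul, hH.det_exp_I_smul, Matrix.trace_smul, trace_pauliString hs]
  simp

lemma isClosed_specialUnitaryGroup (m : Type*) [Fintype m] [DecidableEq m] :
    IsClosed (Matrix.specialUnitaryGroup m ℂ : Set (Matrix m m ℂ)) := by
  have h : (Matrix.specialUnitaryGroup m ℂ : Set (Matrix m m ℂ)) =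
      (unitary (Matrix m m ℂ) : Set (Matrix m m ℂ)) ∩ {U | U.det = 1} := by
    ext U
    exact Matrix.mem_specialUnitaryGroup_iff
  rw [h]
  exact isClosed_unitary.inter (isClosed_eq continuous_id.matrix_det continuous_const)

end Gates

/-- **Universality of the gate set:** the closure in `U(2ⁿ)` of the group generated by
the gates `e^{iφXⱼ}`, `e^{iφZⱼ}`, `e^{iφ·ZXZⱼ}` equals `SU(2ⁿ)` (each generator's
inverse is again a generator, so the generated submonoid is the generated subgroup). -/
theorem gate_set_universal (n : ℕ) (hn : 2 ≤ n) :
    closure ((Submonoid.closure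
        {M : QMat n | ∃ (φ : ℝ) (i : Fin n),
          M = rotGate φ (Xop i) ∨ M = rotGate φ (Zop i) ∨ M = rotGate φ (ZXZop i)} :
        Submonoid (QMat n)) : Set (QMat n)) =
      {U : QMat n | U ∈ Matrix.unitaryGroup (Fin n → Fin 2) ℂ ∧ U.det = 1} := by
  have hne (a : Fin 4) (ha : a ≠ 0) (i : Fin n) : (Pi.single i a : Fin n → Fin 4) ≠ 0 := by
    simpa using ha
  have hzxz (i : Fin n) : zxzString i ≠ 0 := fun h => by
    simpa [zxzString] using congrFun h i
  apply Set.Subset.antisymm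
  · have hset : {U : QMat n | U ∈ Matrix.unitaryGroup (Fin n → Fin 2) ℂ ∧ U.det = 1} =
        (Matrix.specialUnitaryGroup (Fin n → Fin 2) ℂ : Set (QMat n)) := by
      ext U
      exact Matrix.mem_specialUnitaryGroup_iff.symm
    rw [hset]
    refine closure_minimal (Submonoid.closure_le.2 ?_) (isClosed_specialUnitaryGroup _)
    rintro _ ⟨φ, i, rfl | rfl | rfl⟩
    · rw [Xop_eq_pauliString]
      exact rotGate_pauliString_mem_specialUnitaryGroup (hne 1 (by decide) i) φ
    · rw [Zop_eq_pauliString]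
      exact rotGate_pauliString_mem_specialUnitaryGroup (hne 3 (by decide) i) φ
    · rw [ZXZop_eq_pauliString]
      exact rotGate_pauliString_mem_specialUnitaryGroup (hzxz i) φ
  · rintro U ⟨hU, hdet⟩
    obtain ⟨H, hH, htr, rfl⟩ := exists_isHermitian_trace_eq_zero hU hdet
    rw [← Submonoid.coe_topologicalClosure, SetLike.mem_coe]
    have hmem : H ∈ hermitianGenerators (Submonoid.topologicalClosure (Submonoid.closure
        {M : QMat n | ∃ (φ : ℝ) (i : Fin n),
          M = rotGate φ (Xop i) ∨ M = rotGate φ (Zop i) ∨ M = rotGate φ (ZXZop i)})) := by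
      refine mem_hermitianGenerators_of_trace_eq_zero (Submonoid.isClosed_topologicalClosure _)
        (fun i => ⟨?_, fun φ => ?_⟩) (fun i => ⟨?_, fun φ => ?_⟩) (fun i => ⟨?_, fun φ => ?_⟩)
        hH htr
      · rw [Xop_eq_pauliString]
        exact isHermitian_pauliString _
      · exact Submonoid.le_topologicalClosure _
          (Submonoid.subset_closure ⟨φ, i, .inl (mexp_eq_exp _).symm⟩)
      · rw [Zop_eq_pauliString]
        exact isHermitian_pauliString _
      · exact Submonoid.le_topologicalClosure _
          (Submonoid.subset_closure ⟨φ, i, .inr (.inl (mexp_eq_exp _).symm)⟩)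
      · rw [ZXZop_eq_pauliString]
        exact isHermitian_pauliString _
      · exact Submonoid.le_topologicalClosure _
          (Submonoid.subset_closure ⟨φ, i, .inr (.inr (mexp_eq_exp _).symm)⟩)
    simpa using hmem.2 1
end
end

section
/- Let Q_1, …, Q_m be orthogonal projections on a finite-dimensional complex Hilbert space such that each Q_i commutes with all but at most g of the other Q_j, and set H := Σ_{i=1}^m Q_i. Assume ker H ≠ {0}. Then for every unit vector ψ orthogonal to ker H and any ordering of the factors, ‖(1−Q_m)⋯(1−Q_1)ψ‖² ≤ 1/(Δ(H)/g² + 1), where Δ(H) is the smallest nonzero eigenvalue of H. -/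
section Projections

variable {E : Type*} [NormedAddCommGroup E] [InnerProductSpace ℂ E] [FiniteDimensional ℂ E]

/-- The inner product `⟪P x, x⟫` of an orthogonal projection `P` equals `‖P x‖²`. -/
theorem inner_orthProj_self {P : E →ₗ[ℂ] E} (hidem : P ∘ₗ P = P)
    (hadj : LinearMap.adjoint P = P) (x : E) : inner ℂ (P x) x = ((‖P x‖ ^ 2 : ℝ) : ℂ) := by
  have h : P (P x) = P x := LinearMap.congr_fun hidem x
  have h2 : inner ℂ (P (P x)) x = inner ℂ (P x) (P x) := by
    conv_lhs => rw [← hadj]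
    rw [LinearMap.adjoint_inner_left, hadj]
  rw [← h, h2, inner_self_eq_norm_sq_to_K, h]
  norm_cast

/-- Pythagoras for an orthogonal projection and its complement. -/
theorem norm_sq_orthProj_add {P : E →ₗ[ℂ] E} (hidem : P ∘ₗ P = P)
    (hadj : LinearMap.adjoint P = P) (x : E) :
    ‖x - P x‖ ^ 2 + ‖P x‖ ^ 2 = ‖x‖ ^ 2 := by
  have h := @norm_sub_sq ℂ E _ _ _ x (P x)
  have h1 : RCLike.re (inner ℂ x (P x)) = ‖P x‖ ^ 2 := by
    rw [inner_re_symm, inner_orthProj_self hidem hadj x]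
    exact RCLike.ofReal_re (K := ℂ) _
  rw [h1] at h
  linarith

theorem norm_orthProj_le {P : E →ₗ[ℂ] E} (hidem : P ∘ₗ P = P)
    (hadj : LinearMap.adjoint P = P) (x : E) : ‖P x‖ ≤ ‖x‖ := by
  have h := norm_sq_orthProj_add hidem hadj x
  exact le_of_sq_le_sq (by nlinarith [sq_nonneg ‖x - P x‖]) (norm_nonneg _)

theorem norm_sub_orthProj_le {P : E →ₗ[ℂ] E} (hidem : P ∘ₗ P = P)
    (hadj : LinearMap.adjoint P = P) (x : E) : ‖x - P x‖ ≤ ‖x‖ := by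
  have h := norm_sq_orthProj_add hidem hadj x
  exact le_of_sq_le_sq (by nlinarith [sq_nonneg ‖P x‖]) (norm_nonneg _)

/-- Applying complementary projections one after another, the weights `d j` removed at each step
account for the lost norm and control every `‖Q i v‖` for the resulting vector `v`. -/
theorem exists_weights_prod_compl {ι : Type*} [Fintype ι] [DecidableEq ι] (Q : ι → (E →ₗ[ℂ] E))
    (hidem : ∀ i, Q i ∘ₗ Q i = Q i) (hadj : ∀ i, LinearMap.adjoint (Q i) = Q i)
    (N : ι → Finset ι) (hN : ∀ i j, j ≠ i → j ∉ N i → Commute (Q i) (Q j))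
    (ψ : E) (l : List ι) (hl : l.Nodup) :
    ∃ d : ι → ℝ, (∀ i, 0 ≤ d i) ∧ (∀ i, i ∉ l → d i = 0) ∧
      (∀ i ∈ l, ‖Q i ((l.map fun i => (1 : E →ₗ[ℂ] E) - Q i).prod ψ)‖ ≤ ∑ j ∈ N i, d j) ∧
      ∑ j, d j ^ 2 + ‖(l.map fun i => (1 : E →ₗ[ℂ] E) - Q i).prod ψ‖ ^ 2 = ‖ψ‖ ^ 2 := by
  induction l with
  | nil => exact ⟨fun _ => 0, by simp, by simp, by simp, by simp⟩
  | cons a l ih =>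
    obtain ⟨hal, hl⟩ := List.nodup_cons.1 hl
    obtain ⟨d, hd0, hdl, hdN, hds⟩ := ih hl
    set v := (l.map fun i => (1 : E →ₗ[ℂ] E) - Q i).prod ψ with hv
    have hstep : ((a :: l).map fun i => (1 : E →ₗ[ℂ] E) - Q i).prod ψ = v - Q a v := by
      simp [hv]
    have hda : d a = 0 := hdl a hal
    have hd_le : ∀ j, d j ≤ Function.update d a ‖Q a v‖ j := by
      intro j
      by_cases hj : j = a
      · subst hj
        simp [hda]
      · simp [hj]
    have hd0' : ∀ j, 0 ≤ Function.update d a ‖Q a v‖ j := fun j => (hd0 j).trans (hd_le j)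
    refine ⟨Function.update d a ‖Q a v‖, hd0', ?_, ?_, ?_⟩
    · intro i hi
      rw [List.mem_cons, not_or] at hi
      rw [Function.update_of_ne hi.1, hdl i hi.2]
    · intro i hi
      rw [hstep, map_sub]
      by_cases hia : i = a
      · subst hia
        have h : Q i (Q i v) = Q i v := LinearMap.congr_fun (hidem i) v
        rw [h, sub_self, norm_zero]
        exact Finset.sum_nonneg fun j _ => hd0' j
      have hil : i ∈ l := (List.mem_cons.1 hi).resolve_left hia
      have hsum : ∑ j ∈ N i, d j ≤ ∑ j ∈ N i, Function.update d a ‖Q a v‖ j :=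
        Finset.sum_le_sum fun j _ => hd_le j
      by_cases haN : a ∈ N i
      · have hupd : ∑ j ∈ N i, Function.update d a ‖Q a v‖ j = ‖Q a v‖ + ∑ j ∈ N i, d j := by
          rw [Finset.sum_update_of_mem haN, ← Finset.add_sum_erase _ d haN, hda, zero_add,
            Finset.erase_eq]
        rw [hupd]
        calc ‖Q i v - Q i (Q a v)‖ ≤ ‖Q i v‖ + ‖Q i (Q a v)‖ := norm_sub_le _ _
          _ ≤ ‖Q a v‖ + ∑ j ∈ N i, d j := by
            linarith [hdN i hil, norm_orthProj_le (hidem i) (hadj i) (Q a v)]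
      · have hc : Q i (Q a v) = Q a (Q i v) :=
          LinearMap.congr_fun (hN i a (Ne.symm hia) haN).eq v
        rw [hc]
        exact (norm_sub_orthProj_le (hidem a) (hadj a) _).trans ((hdN i hil).trans hsum)
    · rw [hstep, ← hds, ← norm_sq_orthProj_add (hidem a) (hadj a) v]
      have h1 := Finset.add_sum_erase Finset.univ
        (fun j => Function.update d a ‖Q a v‖ j ^ 2) (Finset.mem_univ a)
      have h2 := Finset.add_sum_erase Finset.univ (fun j => d j ^ 2) (Finset.mem_univ a)
      have h3 : ∑ j ∈ Finset.univ.erase a, Function.update d a ‖Q a v‖ j ^ 2 =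
          ∑ j ∈ Finset.univ.erase a, d j ^ 2 :=
        Finset.sum_congr rfl fun j hj => by
          rw [Function.update_of_ne (Finset.ne_of_mem_erase hj)]
      simp only [Function.update_self, hda] at h1 h2
      rw [← h1, ← h2, h3]
      ring

/-- Products of complements of orthogonal projections preserve the orthogonal complement of any
subspace annihilated by the projections. -/
theorem prod_compl_mem_orthogonal {ι : Type*} (Q : ι → (E →ₗ[ℂ] E))
    (hadj : ∀ i, LinearMap.adjoint (Q i) = Q i) (K : Submodule ℂ E)
    (hK : ∀ i, ∀ x ∈ K, Q i x = 0) {ψ : E} (hψ : ψ ∈ Kᗮ) (l : List ι) :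
    (l.map fun i => (1 : E →ₗ[ℂ] E) - Q i).prod ψ ∈ Kᗮ := by
  induction l with
  | nil => simpa using hψ
  | cons a l ih =>
    rw [List.map_cons, List.prod_cons, Module.End.mul_apply, LinearMap.sub_apply,
      Module.End.one_apply]
    refine Submodule.sub_mem _ ih ((Submodule.mem_orthogonal _ _).2 fun u hu => ?_)
    rw [← LinearMap.adjoint_inner_left, hadj, hK a u hu, inner_zero_left]

/-- A positive operator is bounded below by its smallest positive eigenvalue on the orthogonal
complement of its kernel. -/
theorem sInf_eigenvalue_mul_norm_sq_le {H : E →ₗ[ℂ] E} (hH : H.IsPositive) {v : E}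
    (hv : v ∈ (LinearMap.ker H)ᗮ) :
    sInf {c : ℝ | 0 < c ∧ Module.End.HasEigenvalue H (c : ℂ)} * ‖v‖ ^ 2 ≤
      (inner ℂ (H v) v).re := by
  have hS := hH.isSymmetric
  set b := hS.eigenvectorBasis rfl with hb
  set ev := hS.eigenvalues rfl with hev
  have happ : ∀ i, H (b i) = (ev i : ℂ) • b i := fun i => hS.apply_eigenvectorBasis rfl i
  have hin : ∀ i, inner ℂ (H v) (b i) = (ev i : ℂ) * inner ℂ v (b i) := fun i => by
    rw [hS v (b i), happ, inner_smul_right]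
  have hexp : (inner ℂ (H v) v).re = ∑ i, ev i * ‖inner ℂ v (b i)‖ ^ 2 := by
    rw [← b.sum_inner_mul_inner (H v) v, Complex.re_sum]
    refine Finset.sum_congr rfl fun i _ => ?_
    rw [hin, mul_assoc, Complex.re_ofReal_mul, ← inner_conj_symm (b i) v, Complex.mul_conj,
      Complex.ofReal_re, Complex.normSq_eq_norm_sq]
  have hnorm : ‖v‖ ^ 2 = ∑ i, ‖inner ℂ v (b i)‖ ^ 2 := (b.sum_sq_norm_inner_left v).symm
  rw [hexp, hnorm, Finset.mul_sum]
  refine Finset.sum_le_sum fun i _ => ?_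
  rcases (hH.nonneg_eigenvalues rfl i).eq_or_lt with h0 | hpos
  · have hmem : b i ∈ LinearMap.ker H := by
      have h0' : ev i = 0 := h0.symm
      rw [LinearMap.mem_ker, happ, h0', Complex.ofReal_zero, zero_smul]
    rw [Submodule.inner_left_of_mem_orthogonal hmem hv]
    simp
  · exact mul_le_mul_of_nonneg_right
      (csInf_le ⟨0, fun c hc => hc.1.le⟩ ⟨hpos, hS.hasEigenvalue_eigenvalues rfl i⟩)
      (sq_nonneg _)

end Projections

/-- **Generalized detectability lemma.** If `Q₁, …, Q_m` are orthogonal projections,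
each commuting with all but at most `g` of the others, `H = ∑ Qᵢ` has nontrivial
kernel, and `ψ` is a unit vector orthogonal to `ker H`, then for any ordering of the
factors, `‖(1-Q_{σ(m)})⋯(1-Q_{σ(1)})ψ‖² ≤ 1/(Δ(H)/g² + 1)` where `Δ(H)` is the
smallest nonzero eigenvalue of `H`. -/
theorem detectability_lemma {E : Type*} [NormedAddCommGroup E] [InnerProductSpace ℂ E]
    [FiniteDimensional ℂ E] {m : ℕ} (Q : Fin m → (E →ₗ[ℂ] E))
    (hidem : ∀ i, Q i ∘ₗ Q i = Q i)
    (hadj : ∀ i, LinearMap.adjoint (Q i) = Q i)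
    (g : ℕ) (hcomm : ∀ i, {j | j ≠ i ∧ ¬ Commute (Q i) (Q j)}.ncard ≤ g)
    (H : E →ₗ[ℂ] E) (hH : H = ∑ i, Q i)
    (hker : LinearMap.ker H ≠ ⊥)
    (ψ : E) (hψ : ‖ψ‖ = 1) (hperp : ψ ∈ (LinearMap.ker H)ᗮ)
    (σ : Equiv.Perm (Fin m)) :
    ‖(List.ofFn fun i => (1 : E →ₗ[ℂ] E) - Q (σ i)).prod ψ‖ ^ 2 ≤
      1 / (sInf {c : ℝ | 0 < c ∧ Module.End.HasEigenvalue H (c : ℂ)} / (g : ℝ) ^ 2 + 1) := by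
  classical
  set N : Fin m → Finset (Fin m) :=
    fun i => Finset.univ.filter fun j => j ≠ i ∧ ¬ Commute (Q i) (Q j) with hN
  have hcard : ∀ i, (N i).card ≤ g := fun i => by
    have h := hcomm i
    rwa [← Finset.coe_filter_univ, Set.ncard_coe_finset] at h
  have hNsymm : ∀ i j, j ∈ N i ↔ i ∈ N j := fun i j => by
    simp only [hN, Finset.mem_filter_univ, ne_comm (a := i),
      Commute.symm_iff (a := Q i)]
  have hprod : (List.ofFn fun i => (1 : E →ₗ[ℂ] E) - Q (σ i)).prod =
      ((List.ofFn σ).map fun i => (1 : E →ₗ[ℂ] E) - Q i).prod := by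
    rw [List.map_ofFn]
    rfl
  rw [hprod]
  obtain ⟨d, -, -, hdN, hds⟩ := exists_weights_prod_compl Q hidem hadj N
    (fun i j hj hjN => by
      by_contra hc
      exact hjN (by simp [hN, hj, hc]))
    ψ (List.ofFn σ) (List.nodup_ofFn.2 σ.injective)
  have hquad : ∀ x, inner ℂ (H x) x = ((∑ i, ‖Q i x‖ ^ 2 : ℝ) : ℂ) := fun x => by
    rw [hH, LinearMap.sum_apply, sum_inner, Complex.ofReal_sum]
    exact Finset.sum_congr rfl fun i _ => inner_orthProj_self (hidem i) (hadj i) x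
  have hpos : H.IsPositive := by
    refine ⟨?_, fun x => ?_⟩
    · rw [LinearMap.isSymmetric_iff_isSelfAdjoint, LinearMap.isSelfAdjoint_iff', hH, map_sum]
      exact Finset.sum_congr rfl fun i _ => hadj i
    · rw [hquad]
      change 0 ≤ ((∑ i, ‖Q i x‖ ^ 2 : ℝ) : ℂ).re
      rw [Complex.ofReal_re]
      exact Finset.sum_nonneg fun i _ => sq_nonneg ‖Q i x‖
  have hK : ∀ i, ∀ x ∈ LinearMap.ker H, Q i x = 0 := fun i x hx => by
    have h := hquad x
    rw [LinearMap.mem_ker.1 hx, inner_zero_left] at h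
    have h' : ∑ i, ‖Q i x‖ ^ 2 = 0 := by exact_mod_cast h.symm
    have := (Finset.sum_eq_zero_iff_of_nonneg fun i _ => sq_nonneg ‖Q i x‖).1 h' i
      (Finset.mem_univ i)
    simpa using this
  have hgap := sInf_eigenvalue_mul_norm_sq_le hpos
    (prod_compl_mem_orthogonal Q hadj _ hK hperp (List.ofFn σ))
  rw [hquad, Complex.ofReal_re] at hgap
  set v := ((List.ofFn σ).map fun i => (1 : E →ₗ[ℂ] E) - Q i).prod ψ
  set Δ := sInf {c : ℝ | 0 < c ∧ Module.End.HasEigenvalue H (c : ℂ)}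
  have hΔ : 0 ≤ Δ := Real.sInf_nonneg fun c hc => hc.1.le
  have hterm : ∀ i, ‖Q i v‖ ^ 2 ≤ g * ∑ j ∈ N i, d j ^ 2 := fun i =>
    calc ‖Q i v‖ ^ 2 ≤ (∑ j ∈ N i, d j) ^ 2 :=
          pow_le_pow_left₀ (norm_nonneg _)
            (hdN i (List.mem_ofFn.2 (σ.surjective i))) 2
      _ ≤ (N i).card * ∑ j ∈ N i, d j ^ 2 := sq_sum_le_card_mul_sum_sq
      _ ≤ g * ∑ j ∈ N i, d j ^ 2 :=
          mul_le_mul_of_nonneg_right (by exact_mod_cast hcard i)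
            (Finset.sum_nonneg fun j _ => sq_nonneg (d j))
  have hswap : ∑ i, ∑ j ∈ N i, d j ^ 2 ≤ g * ∑ j, d j ^ 2 := by
    rw [Finset.sum_comm' (t' := Finset.univ) (s' := N)
      (fun i j => by simpa using hNsymm i j), Finset.mul_sum]
    refine Finset.sum_le_sum fun j _ => ?_
    rw [Finset.sum_const, nsmul_eq_mul]
    exact mul_le_mul_of_nonneg_right (by exact_mod_cast hcard j) (sq_nonneg _)
  have hsq : ∑ i, ‖Q i v‖ ^ 2 ≤ (g : ℝ) ^ 2 * ∑ j, d j ^ 2 :=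
    calc ∑ i, ‖Q i v‖ ^ 2 ≤ g * ∑ i, ∑ j ∈ N i, d j ^ 2 := by
          rw [Finset.mul_sum]
          exact Finset.sum_le_sum fun i _ => hterm i
      _ ≤ g * (g * ∑ j, d j ^ 2) := mul_le_mul_of_nonneg_left hswap (Nat.cast_nonneg g)
      _ = (g : ℝ) ^ 2 * ∑ j, d j ^ 2 := by ring
  rw [hψ, one_pow] at hds
  have hd0 : 0 ≤ ∑ j, d j ^ 2 := Finset.sum_nonneg fun j _ => sq_nonneg (d j)
  have hfinal : Δ / (g : ℝ) ^ 2 * ‖v‖ ^ 2 ≤ ∑ j, d j ^ 2 := by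
    rw [div_mul_eq_mul_div]
    exact div_le_of_le_mul₀ (sq_nonneg _) hd0 (by linarith)
  rw [le_div_iff₀ (by positivity)]
  linarith
end

section
/- For every n ≥ 2, g(v_n, 2) ≤ 1/√(Δ(H_n)/9 + 1), where Δ(H_n) is the spectral gap of H_n. -/
open MeasureTheory Matrix Finset
open scoped Real ComplexConjugate ComplexOrder

noncomputable section

instance {m n α : Type*} [MeasurableSpace α] : MeasurableSpace (Matrix m n α) :=
  inferInstanceAs (MeasurableSpace (m → n → α))

/-- The operator (spectral) norm of a complex matrix, i.e. the norm of the induced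
linear map between Euclidean spaces. -/
def opNorm {m n : Type*} [Fintype m] [Fintype n] [DecidableEq n] (A : Matrix m n ℂ) : ℝ :=
  ‖LinearMap.toContinuousLinearMap (Matrix.toEuclideanLin A)‖

/-- The spectral gap of a (positive semidefinite) matrix: its smallest nonzero
(= smallest positive) eigenvalue. -/
def specGap {d : Type*} [Fintype d] [DecidableEq d] (A : Matrix d d ℂ) : ℝ :=
  sInf {c : ℝ | 0 < c ∧ (c : ℂ) ∈ spectrum ℂ A}

/-- `U^{⊗t}` as a matrix, entrywise. -/
def tpow {d : Type*} [Fintype d] (t : ℕ) (U : Matrix d d ℂ) :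
    Matrix (Fin t → d) (Fin t → d) ℂ :=
  Matrix.of fun x y => ∏ i, U (x i) (y i)

/-- `U^{⊗t,t} = U^{⊗t} ⊗ (conj U)^{⊗t}` as a matrix, entrywise. -/
def tpow2 {d : Type*} [Fintype d] (t : ℕ) (U : Matrix d d ℂ) :
    Matrix ((Fin t → d) × (Fin t → d)) ((Fin t → d) × (Fin t → d)) ℂ :=
  Matrix.of fun x y => (∏ i, U (x.1 i) (y.1 i)) * ∏ i, conj (U (x.2 i) (y.2 i))

/-- The moment matrix `M_{v,t} = ∫ U^{⊗t,t} dv(U)` of a measure on the unitary group,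
defined entrywise. -/
def Mmat {d : Type*} [Fintype d] [DecidableEq d]
    (v : Measure (Matrix.unitaryGroup d ℂ)) (t : ℕ) :
    Matrix ((Fin t → d) × (Fin t → d)) ((Fin t → d) × (Fin t → d)) ℂ :=
  Matrix.of fun x y => ∫ U, tpow2 t (U : Matrix d d ℂ) x y ∂v

/-- `g(v,t) = ‖M_{v,t} - M_{μ,t}‖` where `μ` is the Haar measure. -/
def gfun {d : Type*} [Fintype d] [DecidableEq d]
    (μ v : Measure (Matrix.unitaryGroup d ℂ)) (t : ℕ) : ℝ :=
  opNorm (Mmat v t - Mmat μ t)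

/-- The uniform probability measure on the box `[0, 2π)^ι`. -/
def unifBox (ι : Type*) [Fintype ι] : Measure (ι → ℝ) :=
  (ENNReal.ofReal ((2 * Real.pi) ^ (Fintype.card ι)))⁻¹ •
    MeasureTheory.volume.restrict (Set.univ.pi fun _ => Set.Ico 0 (2 * Real.pi))

/-- The random circuit of the distribution `v_n`:
`U = (∏ᵢ e^{iφ⁰ᵢ ZXZᵢ})(∏ᵢ e^{iφ¹ᵢ Zᵢ})(∏ᵢ e^{iφ²ᵢ Xᵢ})`. -/
def vnCircuit {n : ℕ} (φ : Fin 3 → Fin n → ℝ) : QMat n :=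
  (List.ofFn fun i : Fin n => rotGate (φ 0 i) (ZXZop i)).prod *
    (List.ofFn fun i : Fin n => rotGate (φ 1 i) (Zop i)).prod *
    (List.ofFn fun i : Fin n => rotGate (φ 2 i) (Xop i)).prod

/-- `P_A := (1/2π)∫₀^{2π} (e^{iφA})^{⊗2,2} dφ`, defined entrywise. -/
def Pproj {n : ℕ} (A : QMat n) :
    Matrix ((Fin 2 → (Fin n → Fin 2)) × (Fin 2 → (Fin n → Fin 2)))
           ((Fin 2 → (Fin n → Fin 2)) × (Fin 2 → (Fin n → Fin 2))) ℂ :=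
  Matrix.of fun x y =>
    ((2 * Real.pi : ℝ) : ℂ)⁻¹ * ∫ φ in (0 : ℝ)..(2 * Real.pi), tpow2 2 (rotGate φ A) x y

/-- `H_n = ∑ᵢ (1 - P^X_i) + ∑ᵢ (1 - P^Z_i) + ∑ᵢ (1 - P^{ZXZ}_i)`. -/
def Hham (n : ℕ) :
    Matrix ((Fin 2 → (Fin n → Fin 2)) × (Fin 2 → (Fin n → Fin 2)))
           ((Fin 2 → (Fin n → Fin 2)) × (Fin 2 → (Fin n → Fin 2))) ℂ :=
  (∑ i : Fin n, (1 - Pproj (Xop i))) + (∑ i : Fin n, (1 - Pproj (Zop i))) +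
    (∑ i : Fin n, (1 - Pproj (ZXZop i)))

/-- `H^L_n = H_n - (1 - P^{ZXZ}_n)` (boundary term at the right edge removed). -/
def HhamL (n : ℕ) (hn : 0 < n) :
    Matrix ((Fin 2 → (Fin n → Fin 2)) × (Fin 2 → (Fin n → Fin 2)))
           ((Fin 2 → (Fin n → Fin 2)) × (Fin 2 → (Fin n → Fin 2))) ℂ :=
  Hham n - (1 - Pproj (ZXZop (⟨n - 1, by omega⟩ : Fin n)))

/-- `H^B_n = H_n - (1 - P^{ZXZ}_1) - (1 - P^{ZXZ}_n)` (both boundary terms removed). -/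
def HhamB (n : ℕ) (hn : 0 < n) :
    Matrix ((Fin 2 → (Fin n → Fin 2)) × (Fin 2 → (Fin n → Fin 2)))
           ((Fin 2 → (Fin n → Fin 2)) × (Fin 2 → (Fin n → Fin 2))) ℂ :=
  HhamL n hn - (1 - Pproj (ZXZop (⟨0, hn⟩ : Fin n)))

/-- The moment matrix `M_{v_n,2} = ∫ U^{⊗2,2} dv_n(U)`, written as an integral over the
uniformly distributed angles defining the random circuit of `v_n`. -/
def MvnMat (n : ℕ) :
    Matrix ((Fin 2 → (Fin n → Fin 2)) × (Fin 2 → (Fin n → Fin 2)))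
           ((Fin 2 → (Fin n → Fin 2)) × (Fin 2 → (Fin n → Fin 2))) ℂ :=
  Matrix.of fun x y =>
    ∫ φ : Fin 3 × Fin n → ℝ, tpow2 2 (vnCircuit fun a i => φ (a, i)) x y
      ∂(unifBox (Fin 3 × Fin n))

section Detectability

variable {E : Type*} [NormedAddCommGroup E] [InnerProductSpace ℂ E] [CompleteSpace E]

theorem IsStarProjection.norm_sq_add {P : E →L[ℂ] E} (hP : IsStarProjection P) (x : E) :
    ‖P x‖ ^ 2 + ‖(1 - P) x‖ ^ 2 = ‖x‖ ^ 2 := by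
  have h0 : inner ℂ (P x) ((1 - P) x) = 0 := by
    rw [← ContinuousLinearMap.adjoint_inner_right, ← ContinuousLinearMap.star_eq_adjoint,
      hP.isSelfAdjoint.star_eq, ← mul_apply_eq_comp, mul_sub, hP.isIdempotentElem.eq]
    simp
  have h := norm_add_sq_eq_norm_sq_add_norm_sq_of_inner_eq_zero (P x) ((1 - P) x) h0
  have hx : P x + (1 - P) x = x := by simp
  rw [hx] at h
  nlinarith [h]

theorem IsStarProjection.norm_apply_le {P : E →L[ℂ] E} (hP : IsStarProjection P) (x : E) :
    ‖P x‖ ≤ ‖x‖ := by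
  have := hP.norm_sq_add x
  exact abs_le_of_sq_le_sq' (by nlinarith [sq_nonneg ‖(1 - P) x‖]) (norm_nonneg x) |>.2

open Classical in
/-- Moving a complementary projection through a product of projections costs only the norm
losses at the factors it fails to commute with. -/
theorem exists_norm_loss {ι : Type*} [Fintype ι] (P : ι → E →L[ℂ] E)
    (hP : ∀ i, IsStarProjection (P i)) (l : List ι) (hl : l.Nodup) (x : E) :
    ∃ δ : ι → ℝ, (∀ j, 0 ≤ δ j) ∧ (∀ j ∉ l, δ j = 0) ∧
      ∑ j, δ j ^ 2 = ‖x‖ ^ 2 - ‖(l.map P).prod x‖ ^ 2 ∧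
      ∀ i ∈ l, ‖(1 - P i) ((l.map P).prod x)‖ ≤ ∑ j with ¬ Commute (P i) (P j), δ j := by
  induction l with
  | nil => exact ⟨0, by simp⟩
  | cons j l ih =>
    obtain ⟨hj, hl⟩ := List.nodup_cons.1 hl
    obtain ⟨δ, h0, hsupp, hsum, hle⟩ := ih hl
    set y := (l.map P).prod x with hy
    have hprod : ((j :: l).map P).prod x = P j y := by simp [hy]
    have hupd : ∀ k, δ k ≤ Function.update δ j ‖(1 - P j) y‖ k := by
      intro k
      rcases eq_or_ne k j with rfl | hk
      · simp [hsupp k hj]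
      · simp [hk]
    have hupd0 : ∀ k, 0 ≤ Function.update δ j ‖(1 - P j) y‖ k := fun k => (h0 k).trans (hupd k)
    refine ⟨Function.update δ j ‖(1 - P j) y‖, hupd0, ?_, ?_, ?_⟩
    · intro k hk
      rw [List.mem_cons, not_or] at hk
      simp [hk.1, hsupp k hk.2]
    · rw [hprod, ← (hP j).norm_sq_add y] at *
      have hs : ∑ k, Function.update δ j ‖(1 - P j) y‖ k ^ 2 = ∑ k, δ k ^ 2 + ‖(1 - P j) y‖ ^ 2 := by
        rw [← Finset.add_sum_erase _ _ (Finset.mem_univ j),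
          ← Finset.add_sum_erase _ (fun k => δ k ^ 2) (Finset.mem_univ j), hsupp j hj]
        rw [Finset.sum_congr rfl fun k hk => by
          rw [Function.update_of_ne (Finset.ne_of_mem_erase hk)]]
        simp [add_comm]
      rw [hs, hsum]; ring
    · intro i hi
      rw [hprod]
      rcases eq_or_ne i j with rfl | hij
      · have : (1 - P i) (P i y) = 0 := by
          rw [← mul_apply_eq_comp, sub_mul, (hP i).isIdempotentElem.eq]; simp
        rw [this, norm_zero]
        exact Finset.sum_nonneg fun k _ => hupd0 k
      have hil : i ∈ l := (List.mem_cons.1 hi).resolve_left hij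
      by_cases hc : Commute (P i) (P j)
      · have hc' : Commute (1 - P i) (P j) := (Commute.one_left _).sub_left hc
        calc ‖(1 - P i) (P j y)‖ = ‖P j ((1 - P i) y)‖ := by
              rw [← mul_apply_eq_comp, hc'.eq, mul_apply_eq_comp]
          _ ≤ ‖(1 - P i) y‖ := (hP j).norm_apply_le _
          _ ≤ _ := hle i hil
          _ ≤ _ := Finset.sum_le_sum fun k _ => hupd k
      · have hdec : (1 - P i) (P j y) = (1 - P i) y - (1 - P i) ((1 - P j) y) := by
          simp only [_root_.sub_apply, map_sub, one_apply_eq_self]; abel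
        have hmem : j ∈ Finset.univ.filter fun k => ¬ Commute (P i) (P k) := by simpa using hc
        calc ‖(1 - P i) (P j y)‖ ≤ ‖(1 - P i) y‖ + ‖(1 - P i) ((1 - P j) y)‖ := by
              rw [hdec]; exact norm_sub_le _ _
          _ ≤ ∑ k with ¬ Commute (P i) (P k), δ k + ‖(1 - P j) y‖ :=
              add_le_add (hle i hil) ((hP i).one_sub.norm_apply_le _)
          _ = _ := by
              rw [← Finset.add_sum_erase _ _ hmem,
                ← Finset.add_sum_erase _ (Function.update δ j ‖(1 - P j) y‖) hmem, hsupp j hj]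
              rw [Finset.sum_congr (f := Function.update δ j ‖(1 - P j) y‖) (g := δ) rfl fun k hk =>
                Function.update_of_ne (Finset.ne_of_mem_erase hk) _ _]
              simp [add_comm]

open Classical in
/-- The detectability lemma: if every projection fails to commute with at most `g` others, the
energy of the product state is controlled by the loss of norm. -/
theorem sum_norm_sq_le_of_commute {ι : Type*} [Fintype ι] (P : ι → E →L[ℂ] E)
    (hP : ∀ i, IsStarProjection (P i)) (l : List ι) (hl : l.Nodup) (hmem : ∀ i, i ∈ l) (g : ℕ)
    (hg : ∀ i, #{j | ¬ Commute (P i) (P j)} ≤ g) (x : E) :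
    ∑ i, ‖(1 - P i) ((l.map P).prod x)‖ ^ 2 ≤
      (g : ℝ) ^ 2 * (‖x‖ ^ 2 - ‖(l.map P).prod x‖ ^ 2) := by
  obtain ⟨δ, h0, -, hsum, hle⟩ := exists_norm_loss P hP l hl x
  rw [← hsum]
  calc ∑ i, ‖(1 - P i) ((l.map P).prod x)‖ ^ 2
      ≤ ∑ i, (∑ j with ¬ Commute (P i) (P j), δ j) ^ 2 :=
        Finset.sum_le_sum fun i _ => pow_le_pow_left₀ (norm_nonneg _) (hle i (hmem i)) 2
    _ ≤ ∑ i, (g : ℝ) * ∑ j with ¬ Commute (P i) (P j), δ j ^ 2 := by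
        refine Finset.sum_le_sum fun i _ => sq_sum_le_card_mul_sum_sq.trans ?_
        exact mul_le_mul_of_nonneg_right (by exact_mod_cast hg i)
          (Finset.sum_nonneg fun j _ => sq_nonneg _)
    _ = (g : ℝ) * ∑ j, (#{i | ¬ Commute (P j) (P i)} : ℝ) * δ j ^ 2 := by
        rw [← Finset.mul_sum]
        simp_rw [Finset.sum_filter]
        rw [Finset.sum_comm]
        congr 1
        refine Finset.sum_congr rfl fun j _ => ?_
        rw [← Finset.sum_filter, Finset.sum_const, nsmul_eq_mul]
        simp only [Commute, SemiconjBy, eq_comm, mul_eq_mul_right_iff]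
        exact Or.inl (by congr!)
    _ ≤ (g : ℝ) * ∑ j, (g : ℝ) * δ j ^ 2 := by
        gcongr with j _
        exact_mod_cast hg j
    _ = _ := by rw [← Finset.mul_sum]; ring

end Detectability

section Gap

variable {d : Type*} [Fintype d] [DecidableEq d]

theorem specGap_nonneg (A : Matrix d d ℂ) : 0 ≤ specGap A :=
  Real.sInf_nonneg fun _ hc => hc.1.le

/-- A vector orthogonal to the kernel of a positive semidefinite matrix has energy at least the
spectral gap. -/
theorem specGap_mul_norm_sq_le {A : Matrix d d ℂ} (hA : A.PosSemidef) (x : EuclideanSpace ℂ d)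
    (hx : ∀ y : EuclideanSpace ℂ d, toEuclideanCLM (𝕜 := ℂ) A y = 0 → inner ℂ y x = 0) :
    specGap A * ‖x‖ ^ 2 ≤ (inner ℂ x (toEuclideanCLM (𝕜 := ℂ) A x)).re := by
  set b := hA.isHermitian.eigenvectorBasis with hb
  set ev := hA.isHermitian.eigenvalues with hev
  have hAb : ∀ i, toEuclideanCLM (𝕜 := ℂ) A (b i) = (ev i : ℂ) • b i := by
    intro i
    apply (WithLp.ofLp_injective 2)
    have := hA.isHermitian.mulVec_eigenvectorBasis i
    simpa [ofLp_toEuclideanCLM] using this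
  have hsa : IsSelfAdjoint (toEuclideanCLM (𝕜 := ℂ) A) := by
    have : star (toEuclideanCLM (𝕜 := ℂ) A) = toEuclideanCLM (𝕜 := ℂ) (star A) :=
      (map_star (toEuclideanCLM (𝕜 := ℂ)) A).symm
    rw [isSelfAdjoint_iff, this, Matrix.star_eq_conjTranspose, hA.isHermitian.eq]
  have hin : ∀ i, inner ℂ (b i) (toEuclideanCLM (𝕜 := ℂ) A x) = (ev i : ℂ) * inner ℂ (b i) x := by
    intro i
    rw [← ContinuousLinearMap.adjoint_inner_left, ← ContinuousLinearMap.star_eq_adjoint,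
      hsa.star_eq, hAb, inner_smul_left, Complex.conj_ofReal]
  rw [← b.sum_inner_mul_inner, ← b.sum_sq_norm_inner_right x, Finset.mul_sum, Complex.re_sum]
  refine Finset.sum_le_sum fun i _ => ?_
  have h1 : inner ℂ x (b i) * inner ℂ (b i) (toEuclideanCLM (𝕜 := ℂ) A x) =
      ((ev i * ‖inner ℂ (b i) x‖ ^ 2 : ℝ) : ℂ) := by
    rw [hin, ← inner_conj_symm x (b i), mul_left_comm, Complex.conj_mul']
    push_cast; rfl
  rw [h1, Complex.ofReal_re]
  rcases (hA.eigenvalues_nonneg i).eq_or_lt with h | h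
  · have : inner ℂ (b i) x = 0 := hx _ (by rw [hAb, hev, ← h]; simp)
    simp [this]
  · refine mul_le_mul_of_nonneg_right ?_ (sq_nonneg _)
    refine csInf_le ⟨0, fun c hc => hc.1.le⟩ ⟨h, ?_⟩
    rw [hA.isHermitian.spectrum_eq_image_range]
    exact ⟨_, ⟨i, rfl⟩, rfl⟩

end Gap

section EntryIntegral

variable {Ω m k : Type*} [MeasurableSpace Ω] {ν : Measure Ω}

/-- The entrywise integral of a matrix-valued function. -/
def entryIntegral (ν : Measure Ω) (F : Ω → Matrix m k ℂ) : Matrix m k ℂ :=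
  of fun x y => ∫ ω, F ω x y ∂ν

theorem entryIntegral_apply (F : Ω → Matrix m k ℂ) (x : m) (y : k) :
    entryIntegral ν F x y = ∫ ω, F ω x y ∂ν := rfl

theorem mul_entryIntegral {l : Type*} [Fintype m] {F : Ω → Matrix m k ℂ}
    (hF : ∀ x y, Integrable (fun ω => F ω x y) ν) (A : Matrix l m ℂ) :
    A * entryIntegral ν F = entryIntegral ν fun ω => A * F ω := by
  ext x y
  simp only [Matrix.mul_apply, entryIntegral_apply]
  rw [integral_finsetSum _ fun z _ => (hF z y).const_mul _]
  simp_rw [integral_const_mul]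

theorem entryIntegral_mul {l : Type*} [Fintype k] {F : Ω → Matrix m k ℂ}
    (hF : ∀ x y, Integrable (fun ω => F ω x y) ν) (A : Matrix k l ℂ) :
    entryIntegral ν F * A = entryIntegral ν fun ω => F ω * A := by
  ext x y
  simp only [Matrix.mul_apply, entryIntegral_apply]
  rw [integral_finsetSum _ fun z _ => (hF x z).mul_const _]
  simp_rw [integral_mul_const]

theorem conjTranspose_entryIntegral (F : Ω → Matrix m k ℂ) :
    (entryIntegral ν F)ᴴ = entryIntegral ν fun ω => (F ω)ᴴ := by
  ext x y
  simp only [conjTranspose_apply, entryIntegral_apply]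
  exact integral_conj.symm

theorem entryIntegral_const [IsProbabilityMeasure ν] (A : Matrix m k ℂ) :
    entryIntegral ν (fun _ => A) = A := by
  ext x y
  simp [entryIntegral_apply]

end EntryIntegral

/-- Integrating a product of matrices that depend on distinct independent variables. -/
theorem integral_list_prod_mul {ι d : Type*} [Fintype ι] [Fintype d]
    [DecidableEq d] (ν : Measure ℝ) [IsProbabilityMeasure ν] (F : ι → ℝ → Matrix d d ℂ)
    (hF : ∀ i x y, Integrable (fun t => F i t x y) ν) (l : List ι) (hl : l.Nodup)
    (g : ι → ℝ → ℂ) (hg : ∀ i, Integrable (g i) ν) (hgl : ∀ i ∈ l, g i = 1) (x y : d) :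
    Integrable (fun φ : ι → ℝ => (l.map fun i => F i (φ i)).prod x y * ∏ i, g i (φ i))
        (Measure.pi fun _ => ν) ∧
      ∫ φ : ι → ℝ, (l.map fun i => F i (φ i)).prod x y * ∏ i, g i (φ i) ∂(Measure.pi fun _ => ν) =
        (l.map fun i => entryIntegral ν (F i)).prod x y * ∏ i, ∫ t, g i t ∂ν := by
  classical
  induction l generalizing g x with
  | nil =>
    simp only [List.map_nil, List.prod_nil]
    refine ⟨(Integrable.fintype_prod hg).const_mul _, ?_⟩
    rw [integral_const_mul, integral_fintype_prod_eq_prod]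
  | cons j l ih =>
    obtain ⟨hj, hl⟩ := List.nodup_cons.1 hl
    have hprod : ∀ (a : ℝ → ℂ) (φ : ι → ℝ),
        ∏ i, Function.update g j a i (φ i) = a (φ j) * ∏ i, g i (φ i) := by
      intro a φ
      rw [← Finset.mul_prod_erase _ _ (Finset.mem_univ j),
        ← Finset.mul_prod_erase _ (fun i => g i (φ i)) (Finset.mem_univ j),
        hgl j List.mem_cons_self]
      simp only [Function.update_self, Pi.one_apply, one_mul]
      congr 1
      exact Finset.prod_congr rfl fun k hk => by
        rw [Function.update_of_ne (Finset.ne_of_mem_erase hk)]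
    have hprodI : ∀ (a : ℝ → ℂ),
        ∏ i, ∫ t, Function.update g j a i t ∂ν = (∫ t, a t ∂ν) * ∏ i, ∫ t, g i t ∂ν := by
      intro a
      rw [← Finset.mul_prod_erase _ _ (Finset.mem_univ j),
        ← Finset.mul_prod_erase _ (fun i => ∫ t, g i t ∂ν) (Finset.mem_univ j),
        hgl j List.mem_cons_self]
      simp only [Function.update_self, Pi.one_apply, integral_const, probReal_univ, one_smul,
        one_mul]
      congr 1
      exact Finset.prod_congr rfl fun k hk => by
        rw [Function.update_of_ne (Finset.ne_of_mem_erase hk)]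
    have key := fun z => ih hl (Function.update g j fun t => F j t x z)
      (by
        intro i
        rcases eq_or_ne i j with rfl | h
        · simpa using hF i x z
        · simpa [h] using hg i)
      (by
        intro i hi
        rw [Function.update_of_ne (by rintro rfl; exact hj hi)]
        exact hgl i (List.mem_cons_of_mem _ hi)) z
    simp only [hprod, hprodI] at key
    have hexp : (fun φ : ι → ℝ => ((j :: l).map fun i => F i (φ i)).prod x y * ∏ i, g i (φ i)) =
        fun φ => ∑ z, (l.map fun i => F i (φ i)).prod z y *
          (F j (φ j) x z * ∏ i, g i (φ i)) := by
      funext φ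
      simp only [List.map_cons, List.prod_cons, Matrix.mul_apply, Finset.sum_mul]
      exact Finset.sum_congr rfl fun z _ => by ring
    rw [hexp]
    refine ⟨integrable_finsetSum _ fun z _ => (key z).1, ?_⟩
    rw [integral_finsetSum _ fun z _ => (key z).1]
    simp only [List.map_cons, List.prod_cons, Matrix.mul_apply, Finset.sum_mul, (key _).2,
      entryIntegral_apply]
    exact Finset.sum_congr rfl fun z _ => by ring

section Circle

/-- The uniform probability measure on `[0, 2π)`. -/
def unifAngle : Measure ℝ :=
  (ENNReal.ofReal (2 * π))⁻¹ • volume.restrict (Set.Ico 0 (2 * π))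

instance : IsProbabilityMeasure unifAngle := by
  constructor
  simp only [unifAngle, Measure.smul_apply, Measure.restrict_apply MeasurableSet.univ,
    Set.univ_inter, Real.volume_Ico, sub_zero, smul_eq_mul]
  exact ENNReal.inv_mul_cancel (by simp [Real.pi_pos]) ENNReal.ofReal_ne_top

theorem integral_unifAngle (f : ℝ → ℂ) :
    ∫ t, f t ∂unifAngle = ((2 * π : ℝ) : ℂ)⁻¹ * ∫ t in (0 : ℝ)..(2 * π), f t := by
  rw [unifAngle, integral_smul_measure, intervalIntegral.integral_of_le Real.two_pi_pos.le,
    integral_Ico_eq_integral_Ioc, ENNReal.toReal_inv, ENNReal.toReal_ofReal Real.two_pi_pos.le,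
    Complex.real_smul, Complex.ofReal_inv]

theorem unifBox_eq_pi (ι : Type*) [Fintype ι] : unifBox ι = Measure.pi fun _ => unifAngle := by
  refine (Measure.pi_eq fun s hs => ?_).symm
  have h2 : ENNReal.ofReal ((2 * π) ^ Fintype.card ι) ≠ 0 := by
    simp only [ne_eq, ENNReal.ofReal_eq_zero, not_le]; positivity
  simp only [unifBox, unifAngle, Measure.smul_apply, smul_eq_mul, Finset.prod_mul_distrib,
    Finset.prod_const, Finset.card_univ]
  rw [ENNReal.ofReal_pow Real.two_pi_pos.le, ENNReal.inv_pow, volume_pi, Measure.restrict_pi_pi,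
    Measure.pi_pi]

theorem Continuous.integrable_unifAngle {f : ℝ → ℂ} (hf : Continuous f) :
    Integrable f unifAngle := by
  refine Integrable.smul_measure ?_ (by simp [Real.pi_pos])
  exact (hf.integrableOn_Icc (a := 0) (b := 2 * π)).mono_set Set.Ico_subset_Icc_self

theorem Function.Periodic.integral_unifAngle_add {f : ℝ → ℂ} (hf : Function.Periodic f (2 * π))
    (s : ℝ) : ∫ t, f (s + t) ∂unifAngle = ∫ t, f t ∂unifAngle := by
  rw [integral_unifAngle, integral_unifAngle, intervalIntegral.integral_comp_add_left, add_zero,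
    hf.intervalIntegral_add_eq s 0, zero_add]

theorem Function.Periodic.integral_unifAngle_neg {f : ℝ → ℂ} (hf : Function.Periodic f (2 * π)) :
    ∫ t, f (-t) ∂unifAngle = ∫ t, f t ∂unifAngle := by
  rw [integral_unifAngle, integral_unifAngle, intervalIntegral.integral_comp_neg, neg_zero]
  have := hf.intervalIntegral_add_eq (-(2 * π)) 0
  rw [neg_add_cancel, zero_add] at this
  rw [this]

end Circle

/-- A continuous `2π`-periodic one-parameter group of unitary matrices. -/
structure IsRotation {d : Type*} [Fintype d] [DecidableEq d] (R : ℝ → Matrix d d ℂ) : Prop where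
  continuous_entry : ∀ x y, Continuous fun t => R t x y
  map_add : ∀ s t, R (s + t) = R s * R t
  periodic : Function.Periodic R (2 * π)
  conjTranspose : ∀ t, (R t)ᴴ = R (-t)

namespace IsRotation

variable {d : Type*} [Fintype d] [DecidableEq d] {R S : ℝ → Matrix d d ℂ}

theorem integrable (hR : IsRotation R) (x y : d) : Integrable (fun t => R t x y) unifAngle :=
  (hR.continuous_entry x y).integrable_unifAngle

theorem periodic_entry (hR : IsRotation R) (x y : d) :
    Function.Periodic (fun t => R t x y) (2 * π) :=
  fun t => by simp only [hR.periodic t]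

theorem mul_entryIntegral (hR : IsRotation R) (s : ℝ) :
    R s * entryIntegral unifAngle R = entryIntegral unifAngle R := by
  rw [_root_.mul_entryIntegral hR.integrable]
  ext x y
  simp only [entryIntegral_apply, ← hR.map_add]
  exact (hR.periodic_entry x y).integral_unifAngle_add s

theorem isStarProjection (hR : IsRotation R) : IsStarProjection (entryIntegral unifAngle R) := by
  constructor
  · rw [IsIdempotentElem, entryIntegral_mul hR.integrable]
    simp_rw [hR.mul_entryIntegral]
    exact entryIntegral_const _
  · rw [isSelfAdjoint_iff, Matrix.star_eq_conjTranspose, conjTranspose_entryIntegral]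
    ext x y
    simp only [entryIntegral_apply, hR.conjTranspose]
    exact (hR.periodic_entry x y).integral_unifAngle_neg

theorem commute (hR : IsRotation R) (hS : IsRotation S) (h : ∀ s t, Commute (R s) (S t)) :
    Commute (entryIntegral unifAngle R) (entryIntegral unifAngle S) := by
  have h1 : ∀ s, Commute (R s) (entryIntegral unifAngle S) := fun s => by
    rw [Commute, SemiconjBy, _root_.mul_entryIntegral hS.integrable, entryIntegral_mul hS.integrable]
    simp only [(h s _).eq]
  rw [Commute, SemiconjBy, _root_.mul_entryIntegral hR.integrable, entryIntegral_mul hR.integrable]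
  simp only [(h1 _).eq]

end IsRotation

section TensorPower

variable {d : Type*}

/-- A vector of `V^{⊗t} ⊗ V̄^{⊗t}` viewed as an operator on `V^{⊗t}`. -/
def vecToMat {t : ℕ} (w : (Fin t → d) × (Fin t → d) → ℂ) : Matrix (Fin t → d) (Fin t → d) ℂ :=
  of fun x y => w (x, y)

theorem vecToMat_injective (t : ℕ) :
    Function.Injective (vecToMat : ((Fin t → d) × (Fin t → d) → ℂ) → _) := by
  intro v w h
  funext x
  exact congrFun₂ h x.1 x.2

/-- The operator `A ⊗ B` on `V^{⊗2}`. -/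
def tensorTwo (A B : Matrix d d ℂ) : Matrix (Fin 2 → d) (Fin 2 → d) ℂ :=
  of fun x y => A (x 0) (y 0) * B (x 1) (y 1)

theorem tensorTwo_add_left (A A' B : Matrix d d ℂ) :
    tensorTwo (A + A') B = tensorTwo A B + tensorTwo A' B := by
  ext x y; simp [tensorTwo, add_mul]

theorem tensorTwo_add_right (A B B' : Matrix d d ℂ) :
    tensorTwo A (B + B') = tensorTwo A B + tensorTwo A B' := by
  ext x y; simp [tensorTwo, mul_add]

theorem tensorTwo_smul_left (c : ℂ) (A B : Matrix d d ℂ) :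
    tensorTwo (c • A) B = c • tensorTwo A B := by
  ext x y; simp [tensorTwo, mul_assoc]

theorem tensorTwo_smul_right (c : ℂ) (A B : Matrix d d ℂ) :
    tensorTwo A (c • B) = c • tensorTwo A B := by
  ext x y; simp [tensorTwo, mul_left_comm]

variable [Fintype d]

theorem tpow_mul (t : ℕ) (A B : Matrix d d ℂ) : tpow t (A * B) = tpow t A * tpow t B := by
  classical
  ext x y
  simp only [tpow, of_apply, Matrix.mul_apply, Finset.prod_univ_sum, Fintype.piFinset_univ,
    Finset.prod_mul_distrib]

theorem tpow_one [DecidableEq d] (t : ℕ) : tpow t (1 : Matrix d d ℂ) = 1 := by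
  ext x y
  simp only [tpow, of_apply, Matrix.one_apply, Finset.prod_ite_zero, Finset.prod_const_one,
    funext_iff, Finset.mem_univ, forall_const]

theorem conjTranspose_tpow (t : ℕ) (A : Matrix d d ℂ) : (tpow t A)ᴴ = tpow t Aᴴ := by
  ext x y
  simp [tpow]

theorem tpow2_apply (t : ℕ) (A : Matrix d d ℂ) (x y : (Fin t → d) × (Fin t → d)) :
    tpow2 t A x y = tpow t A x.1 y.1 * conj (tpow t A x.2 y.2) := by
  simp [tpow2, tpow]

theorem tpow2_mul (t : ℕ) (A B : Matrix d d ℂ) : tpow2 t (A * B) = tpow2 t A * tpow2 t B := by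
  ext x y
  simp only [tpow2_apply, tpow_mul, Matrix.mul_apply, Fintype.sum_prod_type, map_sum,
    Finset.sum_mul_sum, map_mul]
  exact Finset.sum_congr rfl fun _ _ => Finset.sum_congr rfl fun _ _ => by ring

theorem tpow2_one [DecidableEq d] (t : ℕ) : tpow2 t (1 : Matrix d d ℂ) = 1 := by
  ext x y
  simp only [tpow2_apply, tpow_one, Matrix.one_apply, Prod.ext_iff]
  split_ifs <;> simp_all

theorem conjTranspose_tpow2 (t : ℕ) (A : Matrix d d ℂ) : (tpow2 t A)ᴴ = tpow2 t Aᴴ := by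
  ext x y
  simp [tpow2_apply, ← conjTranspose_tpow]

theorem tpow2_list_prod [DecidableEq d] (t : ℕ) (l : List (Matrix d d ℂ)) :
    tpow2 t l.prod = (l.map (tpow2 t)).prod := by
  induction l with
  | nil => exact tpow2_one t
  | cons A l ih => rw [List.prod_cons, tpow2_mul, ih, List.map_cons, List.prod_cons]

theorem vecToMat_tpow2_mulVec (t : ℕ) (A : Matrix d d ℂ) (w : (Fin t → d) × (Fin t → d) → ℂ) :
    vecToMat (tpow2 t A *ᵥ w) = tpow t A * vecToMat w * (tpow t A)ᴴ := by
  ext x y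
  simp only [vecToMat, of_apply, mulVec, dotProduct, tpow2_apply, Fintype.sum_prod_type,
    Matrix.mul_apply, conjTranspose_apply, Finset.sum_mul, RCLike.star_def]
  rw [Finset.sum_comm]
  exact Finset.sum_congr rfl fun _ _ => Finset.sum_congr rfl fun _ _ => by ring

theorem tpow2_mulVec_eq_self_iff [DecidableEq d] (t : ℕ) {U : Matrix d d ℂ}
    (hU : U ∈ unitaryGroup d ℂ) (w : (Fin t → d) × (Fin t → d) → ℂ) :
    tpow2 t U *ᵥ w = w ↔ Commute (tpow t U) (vecToMat w) := by
  have h1 : tpow t U * (tpow t U)ᴴ = 1 := by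
    rw [conjTranspose_tpow, ← tpow_mul, ← Matrix.star_eq_conjTranspose,
      (mem_unitaryGroup_iff.1 hU), tpow_one]
  have h2 : (tpow t U)ᴴ * tpow t U = 1 := by
    rw [conjTranspose_tpow, ← tpow_mul, ← Matrix.star_eq_conjTranspose,
      (mem_unitaryGroup_iff'.1 hU), tpow_one]
  rw [← (vecToMat_injective t).eq_iff, vecToMat_tpow2_mulVec]
  constructor
  · intro h
    rw [Commute, SemiconjBy]
    nth_rw 2 [← h]
    rw [Matrix.mul_assoc, h2, Matrix.mul_one]
  · intro h
    rw [h.eq, Matrix.mul_assoc, h1, Matrix.mul_one]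

theorem tensorTwo_mul (A B A' B' : Matrix d d ℂ) :
    tensorTwo A B * tensorTwo A' B' = tensorTwo (A * A') (B * B') := by
  ext x y
  simp only [tensorTwo, Matrix.mul_apply, of_apply]
  rw [← (finTwoArrowEquiv d).symm.sum_comp, Fintype.sum_prod_type, Finset.sum_mul_sum]
  refine Finset.sum_congr rfl fun _ _ => Finset.sum_congr rfl fun _ _ => ?_
  simp only [finTwoArrowEquiv_symm_apply, cons_val_zero, cons_val_one]
  ring

theorem tpow_two (A : Matrix d d ℂ) : tpow 2 A = tensorTwo A A := by
  ext x y
  simp [tpow, tensorTwo]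

variable [DecidableEq d]

/-- The operators `A` whose infinitesimal action `A ⊗ 1 + 1 ⊗ A` commutes with `W`. -/
def infCommutant (W : Matrix (Fin 2 → d) (Fin 2 → d) ℂ) : Submodule ℂ (Matrix d d ℂ) where
  carrier := {A | Commute (tensorTwo A 1 + tensorTwo 1 A) W}
  add_mem' := by
    intro A B hA hB
    have := Commute.add_left hA hB
    rwa [add_add_add_comm, ← tensorTwo_add_left, ← tensorTwo_add_right] at this
  zero_mem' := by
    have : tensorTwo (0 : Matrix d d ℂ) 1 + tensorTwo 1 0 = 0 := by ext x y; simp [tensorTwo]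
    simp [this]
  smul_mem' := by
    intro c A hA
    have := Commute.smul_left hA c
    simpa only [Set.mem_ofPred_eq, tensorTwo_smul_left, tensorTwo_smul_right, smul_add] using this

theorem mem_infCommutant {W : Matrix (Fin 2 → d) (Fin 2 → d) ℂ} {A : Matrix d d ℂ} :
    A ∈ infCommutant W ↔ Commute (tensorTwo A 1 + tensorTwo 1 A) W := Iff.rfl

theorem one_mem_infCommutant (W : Matrix (Fin 2 → d) (Fin 2 → d) ℂ) : 1 ∈ infCommutant W := by
  rw [mem_infCommutant, ← tpow_two, tpow_one]
  exact (Commute.one_left _).add_left (Commute.one_left _)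

theorem bracket_mem_infCommutant {W : Matrix (Fin 2 → d) (Fin 2 → d) ℂ} {A B : Matrix d d ℂ}
    (hA : A ∈ infCommutant W) (hB : B ∈ infCommutant W) : A * B - B * A ∈ infCommutant W := by
  rw [mem_infCommutant] at *
  have hneg : A * B - B * A = A * B + (-1 : ℂ) • (B * A) := by simp [sub_eq_add_neg]
  suffices h : tensorTwo (A * B - B * A) 1 + tensorTwo 1 (A * B - B * A) =
      (tensorTwo A 1 + tensorTwo 1 A) * (tensorTwo B 1 + tensorTwo 1 B) -
        (tensorTwo B 1 + tensorTwo 1 B) * (tensorTwo A 1 + tensorTwo 1 A) by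
    rw [h]
    exact (hA.mul_left hB).sub_left (hB.mul_left hA)
  simp only [mul_add, add_mul, tensorTwo_mul, one_mul, mul_one, hneg, tensorTwo_add_left,
    tensorTwo_add_right, tensorTwo_smul_left, tensorTwo_smul_right]
  module

theorem commute_tpow_two_of_infCommutant_eq_top {W : Matrix (Fin 2 → d) (Fin 2 → d) ℂ}
    (hW : infCommutant W = ⊤) (A : Matrix d d ℂ) : Commute (tpow 2 A) W := by
  have h : ∀ B : Matrix d d ℂ, Commute (tensorTwo B 1 + tensorTwo 1 B) W := fun B => by
    rw [← mem_infCommutant, hW]; trivial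
  suffices h2 : tpow 2 A = (2⁻¹ : ℂ) • ((tensorTwo A 1 + tensorTwo 1 A) *
      (tensorTwo A 1 + tensorTwo 1 A) - (tensorTwo (A * A) 1 + tensorTwo 1 (A * A))) by
    rw [h2]
    exact (((h A).mul_left (h A)).sub_left (h (A * A))).smul_left _
  simp only [mul_add, add_mul, tensorTwo_mul, one_mul, mul_one, tpow_two]
  module

end TensorPower

section RotGate

variable {n : ℕ}

theorem rotGate_eq {A : QMat n} (hA : A * A = 1) (φ : ℝ) :
    rotGate φ A = (Real.cos φ : ℂ) • (1 : QMat n) + (Complex.I * Real.sin φ) • A := by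
  have hpow : ∀ (z : ℂ) (k : ℕ), (z • A) ^ k =
      z ^ k • ((2⁻¹ : ℂ) • (1 + A)) + (-z) ^ k • ((2⁻¹ : ℂ) • (1 - A)) := by
    intro z k
    induction k with
    | zero => simp only [pow_zero]; module
    | succ k ih =>
      have h1 : ((2⁻¹ : ℂ) • (1 + A)) * (z • A) = z • ((2⁻¹ : ℂ) • (1 + A)) := by
        rw [smul_mul_smul_comm, add_mul, hA, one_mul, smul_smul, add_comm, mul_comm]
      have h2 : ((2⁻¹ : ℂ) • (1 - A)) * (z • A) = (-z) • ((2⁻¹ : ℂ) • (1 - A)) := by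
        rw [smul_mul_smul_comm, sub_mul, hA, one_mul]; module
      rw [pow_succ, ih, add_mul, smul_mul_assoc (z ^ k), smul_mul_assoc ((-z) ^ k), h1, h2,
        smul_smul (z ^ k), smul_smul ((-z) ^ k),
        pow_succ, pow_succ]
  have hs : ∀ (z : ℂ) (B : QMat n), HasSum (fun k : ℕ => ((k.factorial : ℂ)⁻¹ * z ^ k) • B)
      (Complex.exp z • B) := by
    intro z B
    have := NormedSpace.expSeries_div_hasSum_exp (𝔸 := ℂ) z
    rw [← Complex.exp_eq_exp_ℂ] at this
    refine HasSum.smul_const ?_ B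
    simpa only [div_eq_inv_mul] using this
  have hsum := (hs (Complex.I * φ) ((2⁻¹ : ℂ) • (1 + A))).add
    (hs (-(Complex.I * φ)) ((2⁻¹ : ℂ) • (1 - A)))
  rw [rotGate, mexp]
  simp_rw [hpow, smul_add, smul_smul] at hsum ⊢
  simp_rw [mul_assoc] at hsum ⊢
  rw [hsum.tsum_eq, Complex.ofReal_cos, Complex.ofReal_sin, Complex.cos, Complex.sin,
    mul_comm Complex.I (φ : ℂ), ← neg_mul]
  have hI : Complex.I * ((Complex.exp (-↑φ * Complex.I) - Complex.exp (↑φ * Complex.I)) *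
      Complex.I / 2) = (Complex.exp (↑φ * Complex.I) - Complex.exp (-↑φ * Complex.I)) / 2 := by
    linear_combination ((Complex.exp (-↑φ * Complex.I) - Complex.exp (↑φ * Complex.I)) / 2) *
      Complex.I_mul_I
  rw [hI]
  module

theorem rotGate_zero {A : QMat n} (hA : A * A = 1) : rotGate 0 A = 1 := by
  simp [rotGate_eq hA]

theorem rotGate_add {A : QMat n} (hA : A * A = 1) (s t : ℝ) :
    rotGate (s + t) A = rotGate s A * rotGate t A := by
  simp only [rotGate_eq hA, add_mul, mul_add, smul_mul_smul_comm, hA, one_mul, mul_one,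
    Real.cos_add, Real.sin_add]
  push_cast
  have : Complex.I * Complex.sin s * (Complex.I * Complex.sin t) =
      -(Complex.sin s * Complex.sin t) := by
    linear_combination Complex.sin s * Complex.sin t * Complex.I_mul_I
  rw [this]
  module

theorem conjTranspose_rotGate {A : QMat n} (hA : A * A = 1) (hA' : A.IsHermitian) (t : ℝ) :
    (rotGate t A)ᴴ = rotGate (-t) A := by
  rw [rotGate_eq hA, rotGate_eq hA, conjTranspose_add, conjTranspose_smul, conjTranspose_smul,
    hA'.eq, conjTranspose_one]
  simp only [RCLike.star_def, map_mul, Complex.conj_ofReal, Complex.conj_I, Real.cos_neg,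
    Real.sin_neg, Complex.ofReal_neg, neg_mul, mul_neg]

theorem rotGate_mem_unitaryGroup {A : QMat n} (hA : A * A = 1) (hA' : A.IsHermitian) (φ : ℝ) :
    rotGate φ A ∈ unitaryGroup (Fin n → Fin 2) ℂ := by
  rw [mem_unitaryGroup_iff, Matrix.star_eq_conjTranspose, conjTranspose_rotGate hA hA',
    ← rotGate_add hA, add_neg_cancel, rotGate_zero hA]

theorem isRotation_tpow2_rotGate {A : QMat n} (hA : A * A = 1) (hA' : A.IsHermitian) :
    IsRotation fun φ => tpow2 2 (rotGate φ A) where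
  continuous_entry := by
    intro x y
    simp only [tpow2, of_apply, rotGate_eq hA, Matrix.add_apply, Matrix.smul_apply, smul_eq_mul]
    fun_prop
  map_add s t := by rw [← tpow2_mul, rotGate_add hA]
  periodic t := by simp only [rotGate_eq hA, Real.cos_add_two_pi, Real.sin_add_two_pi]
  conjTranspose t := by rw [conjTranspose_tpow2, conjTranspose_rotGate hA hA']

theorem Pproj_eq_entryIntegral (A : QMat n) :
    Pproj A = entryIntegral unifAngle fun φ => tpow2 2 (rotGate φ A) := by
  ext x y
  rw [entryIntegral_apply, integral_unifAngle]
  rfl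

theorem isStarProjection_Pproj {A : QMat n} (hA : A * A = 1) (hA' : A.IsHermitian) :
    IsStarProjection (Pproj A) := by
  rw [Pproj_eq_entryIntegral]
  exact (isRotation_tpow2_rotGate hA hA').isStarProjection

theorem commute_Pproj {A B : QMat n} (hA : A * A = 1) (hA' : A.IsHermitian) (hB : B * B = 1)
    (hB' : B.IsHermitian) (h : Commute A B) : Commute (Pproj A) (Pproj B) := by
  rw [Pproj_eq_entryIntegral, Pproj_eq_entryIntegral]
  refine (isRotation_tpow2_rotGate hA hA').commute (isRotation_tpow2_rotGate hB hB') fun s t => ?_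
  rw [Commute, SemiconjBy, ← tpow2_mul, ← tpow2_mul]
  congr 1
  rw [rotGate_eq hA, rotGate_eq hB]
  exact (((Commute.one_right _).smul_left _).add_left ((Commute.one_right _).smul_left _)).smul_right _
    |>.add_right ((((Commute.one_left _).smul_left _).add_left (h.smul_left _)).smul_right _)

theorem Pproj_mulVec_eq_self {A : QMat n} (hA : A * A = 1) (hA' : A.IsHermitian)
    {w : (Fin 2 → (Fin n → Fin 2)) × (Fin 2 → (Fin n → Fin 2)) → ℂ}
    (hw : Pproj A *ᵥ w = w) (φ : ℝ) : tpow2 2 (rotGate φ A) *ᵥ w = w := by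
  rw [← hw, mulVec_mulVec, Pproj_eq_entryIntegral,
    (isRotation_tpow2_rotGate hA hA').mul_entryIntegral]

theorem mem_infCommutant_of_Pproj_mulVec {A : QMat n} (hA : A * A = 1) (hA' : A.IsHermitian)
    {w : (Fin 2 → (Fin n → Fin 2)) × (Fin 2 → (Fin n → Fin 2)) → ℂ}
    (hw : Pproj A *ᵥ w = w) : A ∈ infCommutant (vecToMat w) := by
  have h : ∀ φ : ℝ, Commute (tpow 2 (rotGate φ A)) (vecToMat w) := fun φ =>
    (tpow2_mulVec_eq_self_iff 2 (rotGate_mem_unitaryGroup hA hA' φ) w).1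
      (Pproj_mulVec_eq_self hA hA' hw φ)
  suffices h2 : tensorTwo A 1 + tensorTwo 1 A =
      (-Complex.I) • (tpow 2 (rotGate (π / 4) A) - tpow 2 (rotGate (-(π / 4)) A)) by
    rw [mem_infCommutant, h2]
    exact ((h (π / 4)).sub_left (h (-(π / 4)))).smul_left _
  simp only [tpow_two, rotGate_eq hA, Real.cos_neg, Real.sin_neg, Real.cos_pi_div_four,
    Real.sin_pi_div_four, tensorTwo_add_left, tensorTwo_add_right, tensorTwo_smul_left,
    tensorTwo_smul_right, Complex.ofReal_neg]
  have h3 : ((√2 / 2 : ℝ) : ℂ) * ((√2 / 2 : ℝ) : ℂ) = 2⁻¹ := by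
    rw [← Complex.ofReal_mul]
    have : √2 / 2 * (√2 / 2) = (2⁻¹ : ℝ) := by
      nlinarith [Real.mul_self_sqrt (show (0 : ℝ) ≤ 2 by norm_num)]
    rw [this]; norm_num
  generalize ((√2 / 2 : ℝ) : ℂ) = c at *
  match_scalars
  · linear_combination 2 * c * c * Complex.I_mul_I - 2 * h3
  · linear_combination 2 * c * c * Complex.I_mul_I - 2 * h3
  · ring
  · ring

end RotGate

section LocalOperators

variable {n : ℕ}

/-- The tensor product of one-qubit operators. -/
def piTensor (a : Fin n → Matrix (Fin 2) (Fin 2) ℂ) : QMat n :=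
  of fun x y => ∏ i, a i (x i) (y i)

theorem piTensor_mul (a b : Fin n → Matrix (Fin 2) (Fin 2) ℂ) :
    piTensor a * piTensor b = piTensor (a * b) := by
  ext x y
  simp only [piTensor, of_apply, Matrix.mul_apply, Pi.mul_apply, Finset.prod_univ_sum,
    Fintype.piFinset_univ, Finset.prod_mul_distrib]

theorem piTensor_one : piTensor (1 : Fin n → Matrix (Fin 2) (Fin 2) ℂ) = 1 := by
  ext x y
  simp only [piTensor, of_apply, Pi.one_apply, Matrix.one_apply, Finset.prod_ite_zero,
    Finset.prod_const_one, funext_iff, Finset.mem_univ, forall_const]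

theorem op1_eq_piTensor (i : Fin n) (A : Matrix (Fin 2) (Fin 2) ℂ) :
    op1 i A = piTensor (Pi.mulSingle i A) := by
  ext x y
  simp only [op1, piTensor, of_apply]
  rw [← Finset.mul_prod_erase _ _ (Finset.mem_univ i), Pi.mulSingle_eq_same]
  congr 1
  refine Finset.prod_congr rfl fun j hj => ?_
  rw [Pi.mulSingle_eq_of_ne (Finset.ne_of_mem_erase hj), Matrix.one_apply]

theorem op1_mul (i : Fin n) (A B : Matrix (Fin 2) (Fin 2) ℂ) :
    op1 i A * op1 i B = op1 i (A * B) := by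
  rw [op1_eq_piTensor, op1_eq_piTensor, op1_eq_piTensor, piTensor_mul, Pi.mulSingle_mul]

theorem op1_one (i : Fin n) : op1 i (1 : Matrix (Fin 2) (Fin 2) ℂ) = 1 := by
  rw [op1_eq_piTensor, Pi.mulSingle_one, piTensor_one]

theorem commute_op1 {i j : Fin n} (h : i ≠ j) (A B : Matrix (Fin 2) (Fin 2) ℂ) :
    Commute (op1 i A) (op1 j B) := by
  rw [op1_eq_piTensor, op1_eq_piTensor, Commute, SemiconjBy, piTensor_mul, piTensor_mul]
  congr 1
  funext k
  rcases eq_or_ne k i with rfl | hki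
  · simp [h]
  · simp [hki]

theorem op1_smul (i : Fin n) (c : ℂ) (A : Matrix (Fin 2) (Fin 2) ℂ) :
    op1 i (c • A) = c • op1 i A := by
  ext x y; simp [op1, mul_assoc]

theorem op1_add (i : Fin n) (A B : Matrix (Fin 2) (Fin 2) ℂ) :
    op1 i (A + B) = op1 i A + op1 i B := by
  ext x y; simp [op1, add_mul]

theorem op1_sub (i : Fin n) (A B : Matrix (Fin 2) (Fin 2) ℂ) :
    op1 i (A - B) = op1 i A - op1 i B := by
  ext x y; simp [op1, sub_mul]

theorem conjTranspose_op1 (i : Fin n) (A : Matrix (Fin 2) (Fin 2) ℂ) :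
    (op1 i A)ᴴ = op1 i Aᴴ := by
  ext x y
  simp only [op1, conjTranspose_apply, of_apply, RCLike.star_def, map_mul, map_prod, eq_comm]
  congr 1
  exact Finset.prod_congr rfl fun j _ => by split_ifs <;> simp

/-- `op1 i` as a linear map. -/
def op1Hom (i : Fin n) : Matrix (Fin 2) (Fin 2) ℂ →ₗ[ℂ] QMat n where
  toFun := op1 i
  map_add' := op1_add i
  map_smul' := op1_smul i

end LocalOperators

section PauliRelations

theorem pauliX_mul_self : pauliX * pauliX = 1 := by
  simp [pauliX, Matrix.one_fin_two]

theorem pauliZ_mul_self : pauliZ * pauliZ = 1 := by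
  simp [pauliZ, Matrix.one_fin_two]

theorem pauliX_mul_pauliZ : pauliX * pauliZ = (-1 : ℂ) • (pauliZ * pauliX) := by
  simp [pauliX, pauliZ]

theorem isHermitian_pauliX : pauliX.IsHermitian := by
  ext i j; fin_cases i <;> fin_cases j <;> simp [pauliX]

theorem isHermitian_pauliZ : pauliZ.IsHermitian := by
  ext i j; fin_cases i <;> fin_cases j <;> simp [pauliZ]

variable {n : ℕ}

theorem Xop_mul_self (i : Fin n) : Xop i * Xop i = 1 := by
  rw [Xop, op1_mul, pauliX_mul_self, op1_one]

theorem Zop_mul_self (i : Fin n) : Zop i * Zop i = 1 := by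
  rw [Zop, op1_mul, pauliZ_mul_self, op1_one]

theorem isHermitian_Xop (i : Fin n) : (Xop i).IsHermitian := by
  rw [Matrix.IsHermitian, Xop, conjTranspose_op1, isHermitian_pauliX.eq]

theorem isHermitian_Zop (i : Fin n) : (Zop i).IsHermitian := by
  rw [Matrix.IsHermitian, Zop, conjTranspose_op1, isHermitian_pauliZ.eq]

/-- `A` and `B` commute up to the scalar `s`. -/
def SignCommute (s : ℂ) (A B : QMat n) : Prop := A * B = s • (B * A)

theorem SignCommute.mul_left {s t : ℂ} {A B C : QMat n} (hA : SignCommute s A C)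
    (hB : SignCommute t B C) : SignCommute (s * t) (A * B) C := by
  rw [SignCommute] at *
  rw [mul_assoc, hB, mul_smul_comm, ← mul_assoc, hA, smul_mul_assoc, smul_smul, mul_assoc,
    mul_comm t]

theorem SignCommute.mul_right {s t : ℂ} {A B C : QMat n} (hB : SignCommute s A B)
    (hC : SignCommute t A C) : SignCommute (s * t) A (B * C) := by
  rw [SignCommute] at *
  rw [← mul_assoc, hB, smul_mul_assoc, mul_assoc, hC, mul_smul_comm, smul_smul, mul_assoc]

theorem signCommute_one_iff {A B : QMat n} : SignCommute 1 A B ↔ Commute A B := by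
  rw [SignCommute, one_smul]; rfl

theorem signCommute_Xop_Zop (i j : Fin n) :
    SignCommute (if i = j then -1 else 1) (Xop i) (Zop j) := by
  split_ifs with h
  · subst h
    rw [SignCommute, Xop, Zop, op1_mul, op1_mul, pauliX_mul_pauliZ, op1_smul]
  · exact signCommute_one_iff.2 (commute_op1 h _ _)

theorem commute_Xop (i j : Fin n) : Commute (Xop i) (Xop j) := by
  rcases eq_or_ne i j with rfl | h
  · exact Commute.refl _
  · exact commute_op1 h _ _

theorem commute_Zop (i j : Fin n) : Commute (Zop i) (Zop j) := by
  rcases eq_or_ne i j with rfl | h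
  · exact Commute.refl _
  · exact commute_op1 h _ _

theorem signCommute_Zop_Xop (i j : Fin n) :
    SignCommute (if i = j then -1 else 1) (Zop i) (Xop j) := by
  have h := signCommute_Xop_Zop j i
  split_ifs with hij
  · rw [if_pos hij.symm, SignCommute] at h
    rw [SignCommute, h, smul_smul]; simp
  · rw [if_neg (Ne.symm hij)] at h
    exact signCommute_one_iff.2 (signCommute_one_iff.1 h).symm

/-- The left factor `Z_{i-1}` of `ZXZ_i`. -/
def Zleft (i : Fin n) : QMat n :=
  if h : 0 < (i : ℕ) then Zop ⟨(i : ℕ) - 1, by have := i.isLt; omega⟩ else 1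

/-- The right factor `Z_{i+1}` of `ZXZ_i`. -/
def Zright (i : Fin n) : QMat n := if h : (i : ℕ) + 1 < n then Zop ⟨(i : ℕ) + 1, h⟩ else 1

theorem ZXZop_eq (i : Fin n) : ZXZop i = Zleft i * Xop i * Zright i := rfl

theorem signCommute_Zleft {A : QMat n} {k : Fin n}
    (hA : ∀ i, SignCommute (if i = k then -1 else 1) (Zop i) A) (j : Fin n) :
    SignCommute (if (k : ℕ) + 1 = j then -1 else 1) (Zleft j) A := by
  unfold Zleft
  by_cases h : 0 < (j : ℕ)
  · rw [dif_pos h]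
    convert hA ⟨(j : ℕ) - 1, by have := j.isLt; omega⟩ using 2
    simp only [Fin.ext_iff]
    omega
  · rw [dif_neg h, if_neg (by omega)]
    exact signCommute_one_iff.2 (Commute.one_left _)

theorem signCommute_Zright {A : QMat n} {k : Fin n}
    (hA : ∀ i, SignCommute (if i = k then -1 else 1) (Zop i) A) (j : Fin n) :
    SignCommute (if (j : ℕ) + 1 = k then -1 else 1) (Zright j) A := by
  unfold Zright
  by_cases h : (j : ℕ) + 1 < n
  · rw [dif_pos h]
    convert hA ⟨(j : ℕ) + 1, h⟩ using 2
    simp only [Fin.ext_iff]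
  · rw [dif_neg h, if_neg (by omega)]
    exact signCommute_one_iff.2 (Commute.one_left _)

theorem commute_Zop_Zleft (i j : Fin n) : Commute (Zop i) (Zleft j) := by
  unfold Zleft
  split_ifs
  exacts [commute_Zop _ _, Commute.one_right _]

theorem commute_Zop_Zright (i j : Fin n) : Commute (Zop i) (Zright j) := by
  unfold Zright
  split_ifs
  exacts [commute_Zop _ _, Commute.one_right _]

theorem Zleft_mul_self (i : Fin n) : Zleft i * Zleft i = 1 := by
  unfold Zleft
  split_ifs
  exacts [Zop_mul_self _, one_mul _]

theorem Zright_mul_self (i : Fin n) : Zright i * Zright i = 1 := by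
  unfold Zright
  split_ifs
  exacts [Zop_mul_self _, one_mul _]

theorem isHermitian_Zleft (i : Fin n) : (Zleft i).IsHermitian := by
  unfold Zleft
  split_ifs
  exacts [isHermitian_Zop _, isHermitian_one]

theorem isHermitian_Zright (i : Fin n) : (Zright i).IsHermitian := by
  unfold Zright
  split_ifs
  exacts [isHermitian_Zop _, isHermitian_one]

theorem commute_Zleft_Xop (i : Fin n) : Commute (Zleft i) (Xop i) := by
  have := signCommute_Zleft (fun j => signCommute_Zop_Xop j i) i
  rwa [if_neg (by omega), signCommute_one_iff] at this

theorem commute_Zright_Xop (i : Fin n) : Commute (Zright i) (Xop i) := by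
  have := signCommute_Zright (fun j => signCommute_Zop_Xop j i) i
  rwa [if_neg (by omega), signCommute_one_iff] at this

theorem commute_Zleft_Zright (i j : Fin n) : Commute (Zleft i) (Zright j) := by
  unfold Zleft
  split_ifs
  exacts [commute_Zop_Zright _ _, Commute.one_left _]

theorem ZXZop_mul_self (i : Fin n) : ZXZop i * ZXZop i = 1 := by
  have h1 : Commute (Zright i) (Zleft i * Xop i) :=
    (commute_Zleft_Zright i i).symm.mul_right (commute_Zright_Xop i)
  rw [ZXZop_eq, h1.mul_mul_mul_comm, (commute_Zleft_Xop i).symm.mul_mul_mul_comm,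
    Zleft_mul_self, Xop_mul_self, Zright_mul_self, one_mul, one_mul]

theorem isHermitian_ZXZop (i : Fin n) : (ZXZop i).IsHermitian := by
  have h1 : Commute (Zright i) (Zleft i * Xop i) :=
    (commute_Zleft_Zright i i).symm.mul_right (commute_Zright_Xop i)
  rw [Matrix.IsHermitian, ZXZop_eq, conjTranspose_mul, conjTranspose_mul,
    (isHermitian_Zleft i).eq, (isHermitian_Zright i).eq, (isHermitian_Xop i).eq,
    ← (commute_Zleft_Xop i).eq, h1.eq]

theorem signCommute_Zop_ZXZop (i k : Fin n) :
    SignCommute (if i = k then -1 else 1) (Zop i) (ZXZop k) := by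
  have := ((signCommute_one_iff.2 (commute_Zop_Zleft i k)).mul_right
    (signCommute_Zop_Xop i k)).mul_right (signCommute_one_iff.2 (commute_Zop_Zright i k))
  rwa [one_mul, mul_one] at this

theorem commute_Zop_ZXZop {i k : Fin n} (h : i ≠ k) : Commute (Zop i) (ZXZop k) := by
  have := signCommute_Zop_ZXZop i k
  rwa [if_neg h, signCommute_one_iff] at this

theorem signCommute_ZXZop_Xop (j k : Fin n) :
    SignCommute ((if (k : ℕ) + 1 = j then -1 else 1) * (if (j : ℕ) + 1 = k then -1 else 1))
      (ZXZop j) (Xop k) := by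
  have := ((signCommute_Zleft (fun i => signCommute_Zop_Xop i k) j).mul_left
    (signCommute_one_iff.2 (commute_Xop j k))).mul_left
    (signCommute_Zright (fun i => signCommute_Zop_Xop i k) j)
  rwa [mul_one] at this

theorem commute_ZXZop_Xop {j k : Fin n} (h1 : (k : ℕ) + 1 ≠ j) (h2 : (j : ℕ) + 1 ≠ k) :
    Commute (ZXZop j) (Xop k) := by
  have := signCommute_ZXZop_Xop j k
  rwa [if_neg h1, if_neg h2, one_mul, signCommute_one_iff] at this

theorem signCommute_Xop_ZXZop (k j : Fin n) :
    SignCommute ((if (k : ℕ) + 1 = j then -1 else 1) * (if (j : ℕ) + 1 = k then -1 else 1))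
      (Xop k) (ZXZop j) := by
  have h := signCommute_ZXZop_Xop j k
  rw [SignCommute] at *
  rw [h, smul_smul]
  split_ifs <;> simp

theorem commute_ZXZop (j k : Fin n) : Commute (ZXZop j) (ZXZop k) := by
  have := ((signCommute_Zleft (fun i => signCommute_Zop_ZXZop i k) j).mul_left
    (signCommute_Xop_ZXZop j k)).mul_left (signCommute_Zright (fun i => signCommute_Zop_ZXZop i k) j)
  rw [← signCommute_one_iff, ZXZop_eq j]
  convert this using 1
  split_ifs <;> simp

end PauliRelations

theorem bracket_mul_mul {R : Type*} [Ring R] {a b b' c : R} (hab : Commute a b')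
    (hac : Commute a c) (hbc : Commute b c) :
    a * b * (b' * c) - b' * c * (a * b) = a * (b * b' - b' * b) * c := by
  have : b' * c * (a * b) = a * (b' * b) * c := by
    rw [mul_assoc, ← mul_assoc c, ← hac.eq, mul_assoc a, ← hbc.eq, ← mul_assoc b', ← hab.eq]
    simp only [mul_assoc]
  rw [this, mul_sub, sub_mul]
  simp only [mul_assoc]

theorem bracket_mul_mul_mul {R : Type*} [Ring R] {a a' x z c : R} (hax : Commute a' x)
    (haz : Commute a z) (hac : Commute a' c) (hzc : Commute z c) :
    a * x * c * (a' * z) - a' * z * (a * x * c) = a * a' * (x * z) * c - a' * a * (z * x) * c := by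
  congr 1
  · rw [mul_assoc, ← mul_assoc c, ← hac.eq, mul_assoc a', ← hzc.eq, mul_assoc a, ← mul_assoc x,
      ← hax.eq]
    simp only [mul_assoc]
  · rw [mul_assoc a', ← mul_assoc z, ← mul_assoc z, ← haz.eq]
    simp only [mul_assoc]

section Universality

/-- A one-qubit operator that, together with the identity, generates all one-qubit operators
under brackets with arbitrary operators. -/
def BracketGenerates (A : Matrix (Fin 2) (Fin 2) ℂ) : Prop :=
  ∀ S : Submodule ℂ (Matrix (Fin 2) (Fin 2) ℂ), 1 ∈ S → (∀ m, ∀ s ∈ S, m * s - s * m ∈ S) →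
    A ∈ S → S = ⊤

theorem bracketGenerates_pauliX : BracketGenerates pauliX := by
  intro S h1 hb hX
  have hZX := hb pauliZ _ hX
  have hZ := hb pauliX _ hZX
  rw [eq_top_iff]
  intro A _
  have : A = ((A 0 0 + A 1 1) / 2) • (1 : Matrix (Fin 2) (Fin 2) ℂ) +
      ((A 0 1 + A 1 0) / 2) • pauliX + ((A 0 1 - A 1 0) / 4) • (pauliZ * pauliX - pauliX * pauliZ) +
      ((A 1 1 - A 0 0) / 8) • (pauliX * (pauliZ * pauliX - pauliX * pauliZ) -
        (pauliZ * pauliX - pauliX * pauliZ) * pauliX) := by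
    ext i j
    fin_cases i <;> fin_cases j <;> simp [pauliX, pauliZ] <;> ring
  rw [this]
  exact S.add_mem (S.add_mem (S.add_mem (S.smul_mem _ h1) (S.smul_mem _ hX)) (S.smul_mem _ hZX))
    (S.smul_mem _ hZ)

theorem bracketGenerates_bracket :
    BracketGenerates (pauliX * pauliZ - pauliZ * pauliX) := by
  intro S h1 hb h
  refine bracketGenerates_pauliX S h1 hb ?_
  convert S.smul_mem (-(1 / 4) : ℂ) (hb pauliZ _ h) using 1
  ext i j
  fin_cases i <;> fin_cases j <;> simp [pauliX, pauliZ] <;> norm_num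

theorem bracketGenerates_pauliZ : BracketGenerates pauliZ := fun S h1 hb h =>
  bracketGenerates_bracket S h1 hb (hb _ _ h)

variable {n : ℕ} (L : Submodule ℂ (QMat n))

/-- All operators supported on the two qubits `i`, `j` lie in `L`. -/
def PairMem (i j : Fin n) : Prop :=
  ∀ A B : Matrix (Fin 2) (Fin 2) ℂ, op1 i A * op1 j B ∈ L

variable {L}

theorem op1_mem (h1 : 1 ∈ L) (hb : ∀ A ∈ L, ∀ B ∈ L, A * B - B * A ∈ L)
    {i : Fin n} (hX : Xop i ∈ L) (hZ : Zop i ∈ L) (A : Matrix (Fin 2) (Fin 2) ℂ) :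
    op1 i A ∈ L := by
  have hS : L.comap (op1Hom i) = ⊤ := by
    have hXZ : op1 i (pauliX * pauliZ - pauliZ * pauliX) ∈ L := by
      rw [op1_sub, ← op1_mul, ← op1_mul]
      exact hb _ hX _ hZ
    rw [eq_top_iff]
    intro A _
    have : A = ((A 0 0 + A 1 1) / 2) • (1 : Matrix (Fin 2) (Fin 2) ℂ) +
        ((A 0 1 + A 1 0) / 2) • pauliX + ((A 0 0 - A 1 1) / 2) • pauliZ +
        ((A 1 0 - A 0 1) / 4) • (pauliX * pauliZ - pauliZ * pauliX) := by
      ext i j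
      fin_cases i <;> fin_cases j <;> simp [pauliX, pauliZ] <;> ring
    rw [this]
    have h1' : (1 : Matrix (Fin 2) (Fin 2) ℂ) ∈ L.comap (op1Hom i) := by
      rw [Submodule.mem_comap]
      change op1 i 1 ∈ L
      rwa [op1_one]
    exact Submodule.add_mem _ (Submodule.add_mem _ (Submodule.add_mem _
      (Submodule.smul_mem _ _ h1') (Submodule.smul_mem _ _ hX)) (Submodule.smul_mem _ _ hZ))
      (Submodule.smul_mem _ _ hXZ)
  have : A ∈ L.comap (op1Hom i) := hS ▸ Submodule.mem_top
  exact this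

theorem pairMem_of_mem (hb : ∀ A ∈ L, ∀ B ∈ L, A * B - B * A ∈ L)
    (hop : ∀ i A, op1 i A ∈ L) {i j : Fin n} (hij : i ≠ j) {A B : Matrix (Fin 2) (Fin 2) ℂ}
    (hA : BracketGenerates A) (hB : BracketGenerates B) (hAB : op1 i A * op1 j B ∈ L) :
    PairMem L i j := by
  have key1 : ∀ A', op1 i A' * op1 j B ∈ L := by
    intro A'
    have hS := hA (L.comap ((LinearMap.mulRight ℂ (op1 j B)).comp (op1Hom i)))
      (by change op1 i 1 * op1 j B ∈ L; rw [op1_one, one_mul]; exact hop j B)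
      (by
        intro m s hs
        change op1 i s * op1 j B ∈ L at hs
        change op1 i (m * s - s * m) * op1 j B ∈ L
        have := hb _ (hop i m) _ hs
        rwa [mul_assoc (op1 i s), ← (commute_op1 hij m B).eq, ← mul_assoc, ← mul_assoc, ← sub_mul,
          op1_mul, op1_mul, ← op1_sub] at this)
      hAB
    have : A' ∈ L.comap ((LinearMap.mulRight ℂ (op1 j B)).comp (op1Hom i)) :=
      hS ▸ Submodule.mem_top
    exact this
  intro A' B'
  have hS := hB (L.comap ((LinearMap.mulLeft ℂ (op1 i A')).comp (op1Hom j)))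
    (by change op1 i A' * op1 j 1 ∈ L; rw [op1_one, mul_one]; exact hop i A')
    (by
      intro m s hs
      change op1 i A' * op1 j s ∈ L at hs
      change op1 i A' * op1 j (m * s - s * m) ∈ L
      have := hb _ (hop j m) _ hs
      rwa [← mul_assoc, ← (commute_op1 hij A' m).eq, mul_assoc, mul_assoc, ← mul_sub,
        op1_mul, op1_mul, ← op1_sub] at this)
    (key1 A')
  have : B' ∈ L.comap ((LinearMap.mulLeft ℂ (op1 i A')).comp (op1Hom j)) :=
    hS ▸ Submodule.mem_top
  exact this

theorem PairMem.trans (hb : ∀ A ∈ L, ∀ B ∈ L, A * B - B * A ∈ L)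
    (hop : ∀ i A, op1 i A ∈ L) {i j k : Fin n} (hij : i ≠ j) (hjk : j ≠ k) (hik : i ≠ k)
    (h1 : PairMem L i j) (h2 : PairMem L j k) : PairMem L i k := by
  refine pairMem_of_mem hb hop hik bracketGenerates_bracket bracketGenerates_pauliX ?_
  set y := pauliZ * (pauliZ * pauliX) - (pauliZ * pauliX) * pauliZ with hy
  have hyX : y * pauliX = (2 : ℂ) • 1 := by
    ext i j; fin_cases i <;> fin_cases j <;> simp [hy, pauliX, pauliZ] <;> norm_num
  have hXy : pauliX * y = (2 : ℂ) • 1 := by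
    ext i j; fin_cases i <;> fin_cases j <;> simp [hy, pauliX, pauliZ] <;> norm_num
  have t1 : op1 i pauliX * op1 j y * op1 k pauliX ∈ L := by
    have := hb _ (h1 pauliX pauliZ) _ (h2 (pauliZ * pauliX) pauliX)
    rwa [bracket_mul_mul (commute_op1 hij _ _) (commute_op1 hik _ _) (commute_op1 hjk _ _),
      op1_mul, op1_mul, ← op1_sub] at this
  have t2 := hb _ t1 _ (h1 pauliZ pauliX)
  rw [bracket_mul_mul_mul (commute_op1 hij _ _) (commute_op1 hij _ _) (commute_op1 hik _ _)
    (commute_op1 hjk _ _), op1_mul, op1_mul, op1_mul, op1_mul, hyX, hXy, op1_smul, op1_one,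
    ← sub_mul, ← sub_mul, ← op1_sub, mul_smul_comm, mul_one, smul_mul_assoc] at t2
  have t3 := L.smul_mem (2⁻¹ : ℂ) t2
  rwa [inv_smul_smul₀ two_ne_zero] at t3

theorem pairMem_of_lt (h1 : 1 ∈ L) (hb : ∀ A ∈ L, ∀ B ∈ L, A * B - B * A ∈ L)
    (hX : ∀ i, Xop i ∈ L) (hZ : ∀ i, Zop i ∈ L) (hZXZ : ∀ i, ZXZop i ∈ L) (k m : ℕ)
    (hm : k + m + 1 < n) : PairMem L ⟨k, by omega⟩ ⟨k + m + 1, hm⟩ := by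
  have hop : ∀ i A, op1 i A ∈ L := fun i A => op1_mem h1 hb (hX i) (hZ i) A
  have hadj : ∀ k (hk : k + 1 < n), PairMem L ⟨k, by omega⟩ ⟨k + 1, hk⟩ := by
    intro k
    induction k with
    | zero =>
      intro hk
      refine pairMem_of_mem hb hop (by simp) bracketGenerates_pauliX bracketGenerates_pauliZ ?_
      have := hZXZ ⟨0, by omega⟩
      simpa [ZXZop, hk, Xop, Zop] using this
    | succ k ih =>
      intro hk
      have hp := ih (by omega)
      refine pairMem_of_mem hb hop (by simp) bracketGenerates_bracket bracketGenerates_pauliZ ?_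
      have h3 : ZXZop (⟨k + 1, by omega⟩ : Fin n) =
          op1 ⟨k, by omega⟩ pauliZ * op1 ⟨k + 1, by omega⟩ pauliX * op1 ⟨k + 2, hk⟩ pauliZ := by
        simp [ZXZop, hk, Xop, Zop]
      have h4 := hb _ (hZXZ ⟨k + 1, by omega⟩) _ (hp pauliZ pauliZ)
      rwa [h3, bracket_mul_mul_mul (commute_op1 (by simp) _ _) (commute_op1 (by simp) _ _)
        (commute_op1 (by simp) _ _) (commute_op1 (by simp) _ _), op1_mul, op1_mul, op1_mul,
        pauliZ_mul_self, op1_one, one_mul, one_mul, ← sub_mul, ← op1_sub] at h4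
  induction m with
  | zero => exact hadj k hm
  | succ m ih =>
    exact (ih (by omega) hadj).trans hb hop (by simp; omega) (by simp) (by simp; omega) (hadj _ hm)

theorem pairMem_of_ne (h1 : 1 ∈ L) (hb : ∀ A ∈ L, ∀ B ∈ L, A * B - B * A ∈ L)
    (hX : ∀ i, Xop i ∈ L) (hZ : ∀ i, Zop i ∈ L) (hZXZ : ∀ i, ZXZop i ∈ L) {i j : Fin n}
    (hij : i ≠ j) : PairMem L i j := by
  wlog h : i < j generalizing i j
  · intro A B
    rw [(commute_op1 hij A B).eq]
    exact this hij.symm (lt_of_le_of_ne (not_lt.1 h) hij.symm) B A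
  obtain ⟨m, hm⟩ := Nat.exists_eq_add_of_lt (Fin.lt_def.1 h)
  obtain ⟨j, hj⟩ := j
  obtain rfl : j = i + m + 1 := hm
  exact pairMem_of_lt h1 hb hX hZ hZXZ i m hj

/-- `piTensor` as a linear function of its factor at site `i`. -/
def piTensorUpdate (a : Fin n → Matrix (Fin 2) (Fin 2) ℂ) (i : Fin n) :
    Matrix (Fin 2) (Fin 2) ℂ →ₗ[ℂ] QMat n where
  toFun c := piTensor (Function.update a i c)
  map_add' c c' := by
    ext x y
    simp only [piTensor, of_apply, Matrix.add_apply]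
    simp only [← Finset.mul_prod_erase _ _ (Finset.mem_univ i), Function.update_self,
      Matrix.add_apply, add_mul]
    congr 2 <;> exact Finset.prod_congr rfl fun j hj => by
      simp only [Function.update_of_ne (Finset.ne_of_mem_erase hj)]
  map_smul' c A := by
    ext x y
    simp only [piTensor, of_apply, Matrix.smul_apply, RingHom.id_apply, smul_eq_mul]
    simp only [← Finset.mul_prod_erase _ _ (Finset.mem_univ i), Function.update_self,
      Matrix.smul_apply, smul_eq_mul, mul_assoc]
    congr 2
    exact Finset.prod_congr rfl fun j hj => by
      simp only [Function.update_of_ne (Finset.ne_of_mem_erase hj)]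

theorem piTensor_mem (h1 : 1 ∈ L) (hb : ∀ A ∈ L, ∀ B ∈ L, A * B - B * A ∈ L)
    (hop : ∀ i A, op1 i A ∈ L) (hpair : ∀ i j, i ≠ j → PairMem L i j) (s : Finset (Fin n))
    (a : Fin n → Matrix (Fin 2) (Fin 2) ℂ) (ha : ∀ i ∉ s, a i = 1) : piTensor a ∈ L := by
  induction s using Finset.strongInduction generalizing a with
  | H s ih =>
    rcases Nat.lt_or_ge 1 s.card with hs | hs
    · obtain ⟨i, hi, j, hj, hij⟩ := Finset.one_lt_card.1 hs
      have hbr : ∀ b c, piTensor (Function.update a i (b * c - c * b)) ∈ L := by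
        intro b c
        have hu : piTensor (Function.update (Function.update a j 1) i b) ∈ L := by
          refine ih (s.erase j) (Finset.erase_ssubset hj) _ fun k hk => ?_
          have hki : k ≠ i := by
            rintro rfl; exact hk (Finset.mem_erase.2 ⟨hij, hi⟩)
          rw [Function.update_of_ne hki]
          rcases eq_or_ne k j with rfl | hkj
          · simp
          · rw [Function.update_of_ne hkj]
            exact ha k fun h => hk (Finset.mem_erase.2 ⟨hkj, h⟩)
        have := hb _ hu _ (hpair i j hij c (a j))
        change piTensorUpdate a i (b * c - c * b) ∈ L
        rw [map_sub]
        change piTensor (Function.update a i (b * c)) - piTensor (Function.update a i (c * b)) ∈ L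
        simp only [op1_eq_piTensor, piTensor_mul] at this
        convert this using 3
        · funext k
          rcases eq_or_ne k i with rfl | hki
          · simp [hij]
          · rcases eq_or_ne k j with rfl | hkj
            · simp [hki]
            · simp [hki, hkj]
        · funext k
          rcases eq_or_ne k i with rfl | hki
          · simp [hij]
          · rcases eq_or_ne k j with rfl | hkj
            · simp [hki]
            · simp [hki, hkj]
      have hS : L.comap (piTensorUpdate a i) = ⊤ := by
        refine bracketGenerates_bracket _ ?_ (fun m t _ => hbr m t) (hbr _ _)
        refine ih (s.erase i) (Finset.erase_ssubset hi) _ fun k hk => ?_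
        rcases eq_or_ne k i with rfl | hki
        · simp
        · rw [Function.update_of_ne hki]
          exact ha k fun h => hk (Finset.mem_erase.2 ⟨hki, h⟩)
      have : a i ∈ L.comap (piTensorUpdate a i) := hS ▸ Submodule.mem_top
      change piTensor (Function.update a i (a i)) ∈ L at this
      rwa [Function.update_eq_self] at this
    · rcases s.eq_empty_or_nonempty with rfl | ⟨i, hi⟩
      · have : a = 1 := funext fun k => ha k (Finset.notMem_empty k)
        rwa [this, piTensor_one]
      have : a = Pi.mulSingle i (a i) := by
        funext k
        rcases eq_or_ne k i with rfl | hki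
        · simp
        · rw [Pi.mulSingle_eq_of_ne hki]
          exact ha k fun h => hki (Finset.card_le_one.1 hs k h i hi)
      rw [this, ← op1_eq_piTensor]
      exact hop _ _

theorem eq_top_of_bracket_mem (h1 : 1 ∈ L) (hb : ∀ A ∈ L, ∀ B ∈ L, A * B - B * A ∈ L)
    (hX : ∀ i, Xop i ∈ L) (hZ : ∀ i, Zop i ∈ L) (hZXZ : ∀ i, ZXZop i ∈ L) : L = ⊤ := by
  rw [eq_top_iff]
  intro A _
  rw [matrix_eq_sum_single A]
  refine L.sum_mem fun x _ => L.sum_mem fun y _ => ?_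
  have : Matrix.single x y (A x y) = A x y • piTensor fun i => Matrix.single (x i) (y i) 1 := by
    ext x' y'
    simp only [Matrix.smul_apply, piTensor, of_apply, Matrix.single_apply, Finset.prod_ite_zero,
      Finset.prod_const_one, Finset.mem_univ, forall_const, forall_and, ← funext_iff, smul_eq_mul,
      mul_ite, mul_one, mul_zero]
  rw [this]
  refine L.smul_mem _ (piTensor_mem h1 hb (fun i A => op1_mem h1 hb (hX i) (hZ i) A)
    (fun i j => pairMem_of_ne h1 hb hX hZ hZXZ) Finset.univ _ (by simp))

end Universality

section Haar

variable {d : Type*} [Fintype d] [DecidableEq d]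

theorem measurable_unitaryGroup_entry (x y : d) :
    Measurable fun U : unitaryGroup d ℂ => (U : Matrix d d ℂ) x y :=
  (measurable_pi_apply y).comp ((measurable_pi_apply x).comp measurable_subtype_coe)

instance : MeasurableMul (unitaryGroup d ℂ) where
  measurable_const_mul V := by
    refine Measurable.subtype_mk (measurable_pi_iff.2 fun x => measurable_pi_iff.2 fun y => ?_)
    simp only [Matrix.mul_apply]
    exact Finset.measurable_sum _ fun z _ => (measurable_unitaryGroup_entry z y).const_mul _
  measurable_mul_const V := by
    refine Measurable.subtype_mk (measurable_pi_iff.2 fun x => measurable_pi_iff.2 fun y => ?_)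
    simp only [Matrix.mul_apply]
    exact Finset.measurable_sum _ fun z _ => (measurable_unitaryGroup_entry x z).mul_const _

variable (μ : Measure (unitaryGroup d ℂ)) [IsProbabilityMeasure μ]

theorem integrable_tpow2_entry (t : ℕ) (x y : (Fin t → d) × (Fin t → d)) :
    Integrable (fun U : unitaryGroup d ℂ => tpow2 t (U : Matrix d d ℂ) x y) μ := by
  refine Integrable.of_bound (C := 1) (Measurable.aestronglyMeasurable ?_)
    (Filter.Eventually.of_forall fun U => ?_)
  · refine Measurable.mul (Finset.measurable_prod _ fun i _ => measurable_unitaryGroup_entry _ _)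
      (Finset.measurable_prod _ fun i _ => ?_)
    exact Complex.continuous_conj.measurable.comp (measurable_unitaryGroup_entry _ _)
  · simp only [tpow2, of_apply, norm_mul, norm_prod, RCLike.norm_conj]
    exact mul_le_one₀ (Finset.prod_le_one (fun _ _ => norm_nonneg _)
      fun _ _ => entry_norm_bound_of_unitary U.2 _ _) (Finset.prod_nonneg fun _ _ => norm_nonneg _)
      (Finset.prod_le_one (fun _ _ => norm_nonneg _)
      fun _ _ => entry_norm_bound_of_unitary U.2 _ _)

theorem tpow2_mul_Mmat [μ.IsMulLeftInvariant] (t : ℕ) (V : unitaryGroup d ℂ) :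
    tpow2 t (V : Matrix d d ℂ) * Mmat μ t = Mmat μ t := by
  change _ * entryIntegral μ (fun U => tpow2 t (U : Matrix d d ℂ)) = _
  rw [mul_entryIntegral (integrable_tpow2_entry μ t)]
  ext x y
  rw [entryIntegral_apply]
  simp only [← tpow2_mul]
  exact integral_mul_left_eq_self (fun U : unitaryGroup d ℂ => tpow2 t (U : Matrix d d ℂ) x y) V

theorem conjTranspose_Mmat_mulVec (t : ℕ) {w : (Fin t → d) × (Fin t → d) → ℂ}
    (hw : ∀ U ∈ unitaryGroup d ℂ, tpow2 t U *ᵥ w = w) : (Mmat μ t)ᴴ *ᵥ w = w := by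
  change (entryIntegral μ (fun U => tpow2 t (U : Matrix d d ℂ)))ᴴ *ᵥ w = _
  have hint : ∀ x y, Integrable
      (fun U : unitaryGroup d ℂ => (tpow2 t (U : Matrix d d ℂ))ᴴ x y) μ := by
    intro x y
    exact (Complex.conjCLE : ℂ →L[ℝ] ℂ).integrable_comp (integrable_tpow2_entry μ t y x)
  have key : (entryIntegral μ (fun U => tpow2 t (U : Matrix d d ℂ)))ᴴ * replicateCol Unit w =
      replicateCol Unit w := by
    rw [conjTranspose_entryIntegral, entryIntegral_mul hint]
    have : ∀ U : unitaryGroup d ℂ, (tpow2 t (U : Matrix d d ℂ))ᴴ * replicateCol Unit w =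
        replicateCol Unit w := by
      intro U
      rw [conjTranspose_tpow2, ← replicateCol_mulVec, ← star_eq_conjTranspose,
        hw (star (U : Matrix d d ℂ)) (star U).2]
    simp_rw [this]
    exact entryIntegral_const _
  rw [← replicateCol_mulVec] at key
  exact replicateCol_injective key

end Haar

section Reflection

variable {D ι : Type*} [Fintype D]

theorem inner_list_prod_apply {E : Type*} [NormedAddCommGroup E] [InnerProductSpace ℂ E]
    [CompleteSpace E] (l : List (E →L[ℂ] E)) (w x : E)
    (h : ∀ Q ∈ l, IsStarProjection Q ∧ Q w = w) : inner ℂ w (l.prod x) = inner ℂ w x := by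
  induction l with
  | nil => simp
  | cons Q l ih =>
    have hQ := h Q (by simp)
    rw [List.prod_cons, mul_apply_eq_comp, ← ContinuousLinearMap.adjoint_inner_left,
      ← ContinuousLinearMap.star_eq_adjoint, hQ.1.isSelfAdjoint.star_eq, hQ.2]
    exact ih fun Q' hQ' => h Q' (by simp [hQ'])

theorem posSemidef_of_isStarProjection {Q : Matrix D D ℂ} (hQ : IsStarProjection Q) :
    Q.PosSemidef := by
  have := posSemidef_conjTranspose_mul_self Q
  rwa [← star_eq_conjTranspose, hQ.isSelfAdjoint.star_eq, hQ.isIdempotentElem.eq] at this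

variable [DecidableEq D]

theorem re_inner_sum_one_sub [Fintype ι] {P : ι → Matrix D D ℂ}
    (hP : ∀ i, IsStarProjection (P i)) (x : EuclideanSpace ℂ D) :
    (inner ℂ x (toEuclideanCLM (𝕜 := ℂ) (∑ i, (1 - P i)) x)).re =
      ∑ i, ‖(1 - toEuclideanCLM (𝕜 := ℂ) (P i)) x‖ ^ 2 := by
  rw [map_sum, _root_.sum_apply, inner_sum, Complex.re_sum]
  refine Finset.sum_congr rfl fun i _ => ?_
  rw [map_sub, map_one]
  have hQ := ((hP i).map (toEuclideanCLM (𝕜 := ℂ) (n := D))).one_sub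
  set Q := 1 - toEuclideanCLM (𝕜 := ℂ) (P i)
  have : Q x = Q (Q x) := by rw [← mul_apply_eq_comp, hQ.isIdempotentElem.eq]
  rw [this, ← ContinuousLinearMap.adjoint_inner_left, ← ContinuousLinearMap.star_eq_adjoint,
    hQ.isSelfAdjoint.star_eq, ← this]
  exact (norm_sq_eq_re_inner (𝕜 := ℂ) (Q x)).symm

open Classical in
theorem opNorm_list_prod_sub_le [Fintype ι] (P : ι → Matrix D D ℂ)
    (hP : ∀ i, IsStarProjection (P i)) (l : List ι) (hl : l.Nodup) (hmem : ∀ i, i ∈ l) (g : ℕ)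
    (hg0 : 0 < g) (hg : ∀ i, #{j | ¬ Commute (P i) (P j)} ≤ g) (M : Matrix D D ℂ)
    (hPM : ∀ i, P i * M = M) (hM : ∀ w, (∀ i, P i *ᵥ w = w) → Mᴴ *ᵥ w = w) :
    opNorm ((l.map P).prod - M) ≤ 1 / √(specGap (∑ i, (1 - P i)) / (g : ℝ) ^ 2 + 1) := by
  set T := toEuclideanCLM (𝕜 := ℂ) (n := D) with hT
  set Δ := specGap (∑ i, (1 - P i)) with hΔ
  have hΔ0 : 0 ≤ Δ := specGap_nonneg _
  have hTP : ∀ i, IsStarProjection (T (P i)) := fun i => (hP i).map T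
  have hprodM : (l.map P).prod * M = M := by
    clear hl hmem
    induction l with
    | nil => simp
    | cons i l ih => rw [List.map_cons, List.prod_cons, mul_assoc, ih, hPM]
  have hTprod : T (l.map P).prod = (l.map fun i => T (P i)).prod := by
    rw [map_list_prod, List.map_map]; rfl
  have hker : ∀ w, T (∑ i, (1 - P i)) w = 0 → ∀ i, T (P i) w = w := by
    intro w hw i
    have h := re_inner_sum_one_sub hP w
    rw [← hT, hw, inner_zero_right, Complex.zero_re, eq_comm,
      Finset.sum_eq_zero_iff_of_nonneg fun _ _ => sq_nonneg _] at h
    have := h i (Finset.mem_univ i)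
    rw [sq_eq_zero_iff, norm_eq_zero] at this
    exact (sub_eq_zero.1 this).symm
  have hadj : ∀ w, (∀ i, T (P i) w = w) → ∀ x, inner ℂ w (T M x) = inner ℂ w x := by
    intro w hw x
    rw [← ContinuousLinearMap.adjoint_inner_left, ← ContinuousLinearMap.star_eq_adjoint,
      ← map_star, star_eq_conjTranspose]
    congr 1
    apply WithLp.ofLp_injective 2
    rw [hT, ofLp_toEuclideanCLM]
    refine hM _ fun i => ?_
    rw [← ofLp_toEuclideanCLM, ← hT, hw]
  have hTM : ∀ x i, T (P i) (T M x) = T M x := fun x i => by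
    rw [← mul_apply_eq_comp, ← map_mul, hPM]
  refine ContinuousLinearMap.opNorm_le_bound _ (by positivity) fun x => ?_
  change ‖T ((l.map P).prod - M) x‖ ≤ _
  set x' := x - T M x with hx'
  have hx'ker : ∀ w, (∀ i, T (P i) w = w) → inner ℂ w x' = 0 := fun w hw => by
    rw [hx', inner_sub_right, hadj w hw, sub_self]
  have hφ : T ((l.map P).prod - M) x = (l.map fun i => T (P i)).prod x' := by
    rw [← hTprod, hx', map_sub (T (l.map P).prod), ← mul_apply_eq_comp, ← map_mul, hprodM, map_sub]
    rfl
  rw [hφ]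
  set φ := (l.map fun i => T (P i)).prod x' with hφdef
  have hφker : ∀ w, T (∑ i, (1 - P i)) w = 0 → inner ℂ w φ = 0 := by
    intro w hw
    rw [hφdef, inner_list_prod_apply, hx'ker w (hker w hw)]
    intro Q hQ
    obtain ⟨i, -, rfl⟩ := List.mem_map.1 hQ
    exact ⟨hTP i, hker w hw i⟩
  have hgap : Δ * ‖φ‖ ^ 2 ≤ (g : ℝ) ^ 2 * (‖x'‖ ^ 2 - ‖φ‖ ^ 2) := by
    have hpsd : (∑ i, (1 - P i)).PosSemidef :=
      posSemidef_sum _ fun i _ => posSemidef_of_isStarProjection (hP i).one_sub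
    have h1 := specGap_mul_norm_sq_le hpsd φ hφker
    rw [re_inner_sum_one_sub hP] at h1
    refine h1.trans (sum_norm_sq_le_of_commute _ hTP l hl hmem g (fun i => ?_) x')
    refine le_trans (Finset.card_le_card fun j hj => ?_) (hg i)
    simp only [Finset.mem_filter, Finset.mem_univ, true_and] at hj ⊢
    exact fun h => hj (h.map T)
  have hpyth : ‖x'‖ ^ 2 ≤ ‖x‖ ^ 2 := by
    have h0 : inner ℂ (T M x) x' = 0 := hx'ker _ (hTM x)
    have h1 : x = T M x + x' := by rw [hx']; abel
    have h2 := norm_add_sq_eq_norm_sq_add_norm_sq_of_inner_eq_zero _ _ h0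
    rw [← h1] at h2
    nlinarith [sq_nonneg ‖T M x‖]
  have hg2 : (0 : ℝ) < (g : ℝ) ^ 2 := by positivity
  have hs : 0 < Δ / (g : ℝ) ^ 2 + 1 := by positivity
  rw [div_mul_eq_mul_div, one_mul, le_div_iff₀ (Real.sqrt_pos.2 hs)]
  refine abs_le_of_sq_le_sq' ?_ (norm_nonneg _) |>.2
  rw [mul_pow, Real.sq_sqrt hs.le]
  refine le_trans ?_ hpyth
  have : Δ / (g : ℝ) ^ 2 * ‖φ‖ ^ 2 ≤ ‖x'‖ ^ 2 - ‖φ‖ ^ 2 := by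
    rw [div_mul_eq_mul_div, div_le_iff₀ hg2]; linarith
  linarith

end Reflection

section Circuit

variable {n : ℕ}

/-- The generators of the circuit, layer by layer. -/
def circuitGen (p : Fin 3 × Fin n) : QMat n :=
  ![ZXZop p.2, Zop p.2, Xop p.2] p.1

/-- The gate positions in the order in which they appear in the circuit. -/
def circuitList (n : ℕ) : List (Fin 3 × Fin n) :=
  (List.ofFn fun i => (0, i)) ++ (List.ofFn fun i => (1, i)) ++ List.ofFn fun i => (2, i)

theorem nodup_circuitList : (circuitList n).Nodup := by
  have h : ∀ a : Fin 3, (List.ofFn fun i : Fin n => (a, i)).Nodup := fun a =>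
    List.nodup_ofFn.2 fun i j h => (Prod.ext_iff.1 h).2
  have hd : ∀ a b : Fin 3, a ≠ b →
      List.Disjoint (List.ofFn fun i : Fin n => (a, i)) (List.ofFn fun i : Fin n => (b, i)) := by
    intro a b hab p ha hb
    obtain ⟨i, rfl⟩ := List.mem_ofFn.1 ha
    obtain ⟨j, hj⟩ := List.mem_ofFn.1 hb
    exact hab (Prod.ext_iff.1 hj).1.symm
  exact ((h 0).append (h 1) (hd 0 1 (by decide))).append (h 2)
    (List.disjoint_append_left.2 ⟨hd 0 2 (by decide), hd 1 2 (by decide)⟩)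

theorem mem_circuitList (p : Fin 3 × Fin n) : p ∈ circuitList n := by
  obtain ⟨a, i⟩ := p
  fin_cases a <;> simp [circuitList, List.mem_ofFn]

theorem circuitGen_mul_self (p : Fin 3 × Fin n) : circuitGen p * circuitGen p = 1 := by
  obtain ⟨a, i⟩ := p
  fin_cases a
  exacts [ZXZop_mul_self i, Zop_mul_self i, Xop_mul_self i]

theorem isHermitian_circuitGen (p : Fin 3 × Fin n) : (circuitGen p).IsHermitian := by
  obtain ⟨a, i⟩ := p
  fin_cases a
  exacts [isHermitian_ZXZop i, isHermitian_Zop i, isHermitian_Xop i]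

theorem vnCircuit_eq (φ : Fin 3 × Fin n → ℝ) :
    vnCircuit (fun a i => φ (a, i)) =
      ((circuitList n).map fun p => rotGate (φ p) (circuitGen p)).prod := by
  simp only [vnCircuit, circuitList, List.map_append, List.prod_append, List.map_ofFn]
  rfl

theorem MvnMat_eq : MvnMat n = ((circuitList n).map fun p => Pproj (circuitGen p)).prod := by
  ext x y
  simp only [MvnMat, of_apply, vnCircuit_eq, tpow2_list_prod, List.map_map, unifBox_eq_pi,
    Function.comp_def, Pproj_eq_entryIntegral]
  have := (integral_list_prod_mul unifAngle
    (fun (p : Fin 3 × Fin n) φ => tpow2 2 (rotGate φ (circuitGen p)))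
    (fun p => (isRotation_tpow2_rotGate (circuitGen_mul_self p)
      (isHermitian_circuitGen p)).integrable) (circuitList n) nodup_circuitList
    (fun _ => 1) (fun _ => integrable_const _) (fun _ _ => rfl) x y).2
  simpa using this

theorem Hham_eq : Hham n = ∑ p : Fin 3 × Fin n, (1 - Pproj (circuitGen p)) := by
  rw [Fintype.sum_prod_type, Fin.sum_univ_three]
  simp only [circuitGen, Hham]
  simp only [Matrix.cons_val]
  abel

/-- A set of positions containing all generators that fail to commute with a given one. -/
def circuitNeighbors (p : Fin 3 × Fin n) : Finset (Fin 3 × ℤ) :=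
  ![{(1, (p.2 : ℤ)), (2, (p.2 : ℤ) - 1), (2, (p.2 : ℤ) + 1)}, {(0, (p.2 : ℤ)), (2, (p.2 : ℤ))},
    {(1, (p.2 : ℤ)), (0, (p.2 : ℤ) - 1), (0, (p.2 : ℤ) + 1)}] p.1

theorem card_circuitNeighbors_le (p : Fin 3 × Fin n) : #(circuitNeighbors p) ≤ 3 := by
  obtain ⟨a, i⟩ := p
  fin_cases a
  exacts [Finset.card_le_three, Finset.card_le_two.trans (by norm_num), Finset.card_le_three]

theorem commute_circuitGen {p q : Fin 3 × Fin n}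
    (h : (q.1, ((q.2 : ℕ) : ℤ)) ∉ circuitNeighbors p) :
    Commute (circuitGen p) (circuitGen q) := by
  obtain ⟨a, i⟩ := p
  obtain ⟨b, j⟩ := q
  fin_cases a <;> fin_cases b <;>
    simp [circuitNeighbors, circuitGen, -Nat.cast_inj] at h ⊢
  · exact commute_ZXZop i j
  · exact (commute_Zop_ZXZop (by omega)).symm
  · exact commute_ZXZop_Xop (by omega) (by omega)
  · exact commute_Zop_ZXZop (by omega)
  · exact commute_Zop i j
  · exact commute_op1 (by omega) _ _
  · exact (commute_ZXZop_Xop (by omega) (by omega)).symm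
  · exact commute_op1 (by omega) _ _
  · exact commute_Xop i j

open Classical in
theorem card_not_commute_Pproj_le (p : Fin 3 × Fin n) :
    #{q | ¬ Commute (Pproj (circuitGen p)) (Pproj (circuitGen q))} ≤ 3 := by
  refine le_trans (Finset.card_le_card_of_injOn (fun q => (q.1, ((q.2 : ℕ) : ℤ))) ?_ ?_)
    (card_circuitNeighbors_le p)
  · intro q hq
    simp only [Finset.coe_filter, Finset.mem_univ, true_and, Set.mem_ofPred_eq] at hq
    by_contra h
    exact hq (commute_Pproj (circuitGen_mul_self p) (isHermitian_circuitGen p)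
      (circuitGen_mul_self q) (isHermitian_circuitGen q) (commute_circuitGen h))
  · rintro ⟨a, i⟩ - ⟨b, j⟩ - h
    simpa [Fin.ext_iff] using h

theorem tpow2_mulVec_of_Pproj_mulVec
    {w : (Fin 2 → (Fin n → Fin 2)) × (Fin 2 → (Fin n → Fin 2)) → ℂ}
    (hw : ∀ p : Fin 3 × Fin n, Pproj (circuitGen p) *ᵥ w = w) {U : QMat n}
    (hU : U ∈ unitaryGroup (Fin n → Fin 2) ℂ) : tpow2 2 U *ᵥ w = w := by
  rw [tpow2_mulVec_eq_self_iff 2 hU]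
  have hL : ∀ p, circuitGen p ∈ infCommutant (vecToMat w) := fun p =>
    mem_infCommutant_of_Pproj_mulVec (circuitGen_mul_self p) (isHermitian_circuitGen p) (hw p)
  exact commute_tpow_two_of_infCommutant_eq_top (eq_top_of_bracket_mem (one_mem_infCommutant _)
    (fun A hA B hB => bracket_mem_infCommutant hA hB) (fun i => hL (2, i)) (fun i => hL (1, i))
    fun i => hL (0, i)) U

theorem Pproj_mul_Mmat (μ : Measure (unitaryGroup (Fin n → Fin 2) ℂ)) [IsProbabilityMeasure μ]
    [μ.IsMulLeftInvariant] {A : QMat n} (hA : A * A = 1) (hA' : A.IsHermitian) :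
    Pproj A * Mmat μ 2 = Mmat μ 2 := by
  rw [Pproj_eq_entryIntegral, entryIntegral_mul (isRotation_tpow2_rotGate hA hA').integrable]
  have : ∀ φ, tpow2 2 (rotGate φ A) * Mmat μ 2 = Mmat μ 2 := fun φ =>
    tpow2_mul_Mmat μ 2 ⟨_, rotGate_mem_unitaryGroup hA hA' φ⟩
  simp_rw [this]
  exact entryIntegral_const _

end Circuit

/-- **Detectability lemma bound:** `g(v_n, 2) ≤ 1/√(Δ(H_n)/9 + 1)`. -/
theorem detectability_bound (n : ℕ) (hn : 2 ≤ n)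
    (μ : Measure (Matrix.unitaryGroup (Fin n → Fin 2) ℂ))
    [IsProbabilityMeasure μ] [μ.IsMulLeftInvariant] :
    opNorm (MvnMat n - Mmat μ 2) ≤ 1 / Real.sqrt (specGap (Hham n) / 9 + 1) := by
  have h := opNorm_list_prod_sub_le (fun p : Fin 3 × Fin n => Pproj (circuitGen p))
    (fun p => isStarProjection_Pproj (circuitGen_mul_self p) (isHermitian_circuitGen p))
    (circuitList n) nodup_circuitList mem_circuitList 3 three_pos card_not_commute_Pproj_le
    (Mmat μ 2) (fun p => Pproj_mul_Mmat μ (circuitGen_mul_self p) (isHermitian_circuitGen p))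
    (fun w hw => conjTranspose_Mmat_mulVec μ 2 fun U hU => tpow2_mulVec_of_Pproj_mulVec hw hU)
  rw [MvnMat_eq, Hham_eq]
  convert h using 4
  norm_num
end
end
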